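/- arXiv:1109.3057 — 6 statements merged into one kernel-verified Lean document; each statement's English description precedes it below -/
import Mathlib

section
/- For all real numbers a, b ≥ 0, exp(-(a+b)) - exp(-a) - exp(-b) ≤ exp(-2√(ab)) - 2·exp(-√(ab)). -/
theorem aux_antitone {x y : ℝ} (hx : 0 < x) (hxy : x ≤ y) :
    Real.exp (-y) * y / (1 - Real.exp (-y)) ≤ Real.exp (-x) * x / (1 - Real.exp (-x)) := by
  have hy : 0 < y := hx.trans_le hxy
  have h1 : 0 < 1 - Real.exp (-y) := by
    have := Real.exp_lt_exp.2 (show -y < 0 by linarith)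
    rw [Real.exp_zero] at this
    linarith
  have h2 : 0 < 1 - Real.exp (-x) := by
    have := Real.exp_lt_exp.2 (show -x < 0 by linarith)
    rw [Real.exp_zero] at this
    linarith
  have hc := convexOn_exp.2 (Set.mem_univ 0) (Set.mem_univ y)
    (show 0 ≤ 1 - x / y by rw [sub_nonneg, div_le_one hy]; exact hxy)
    (show 0 ≤ x / y by positivity) (by ring)
  have e : (1 - x / y) • (0 : ℝ) + (x / y) • y = x := by
    simp only [smul_eq_mul]; field_simp; ring
  rw [e] at hc
  simp only [smul_eq_mul, Real.exp_zero, mul_one] at hc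
  have hc' : y * (Real.exp x - 1) ≤ x * (Real.exp y - 1) := by
    have h := mul_le_mul_of_nonneg_left hc hy.le
    have e2 : y * (1 - x / y + x / y * Real.exp y) = y - x + x * Real.exp y := by
      field_simp
    rw [e2] at h
    linarith
  rw [div_le_div_iff₀ h1 h2]
  have ex : Real.exp (-x) * Real.exp x = 1 := by rw [← Real.exp_add]; simp
  have ey : Real.exp (-y) * Real.exp y = 1 := by rw [← Real.exp_add]; simp
  have h := mul_le_mul_of_nonneg_left hc' (mul_pos (Real.exp_pos (-x)) (Real.exp_pos (-y))).le
  have l : Real.exp (-x) * Real.exp (-y) * (y * (Real.exp x - 1))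
      = Real.exp (-y) * y * (1 - Real.exp (-x)) := by
    linear_combination (Real.exp (-y) * y) * ex
  have r : Real.exp (-x) * Real.exp (-y) * (x * (Real.exp y - 1))
      = Real.exp (-x) * x * (1 - Real.exp (-y)) := by
    linear_combination (Real.exp (-x) * x) * ey
  rw [l, r] at h
  exact h

theorem aux_pos (t : ℝ) : 0 < 1 - Real.exp (-Real.exp t) := by
  have := Real.exp_lt_exp.2 (show -Real.exp t < 0 by linarith [Real.exp_pos t])
  rw [Real.exp_zero] at this
  linarith

theorem aux_deriv (t : ℝ) : HasDerivAt (fun t => Real.log (1 - Real.exp (-Real.exp t)))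
    (Real.exp (-Real.exp t) * Real.exp t / (1 - Real.exp (-Real.exp t))) t := by
  have h := ((((Real.hasDerivAt_exp t).neg).exp).const_sub 1).log (aux_pos t).ne'
  convert h using 1
  · rfl
  · have e : (-Real.exp) t = -Real.exp t := rfl
    rw [e]
    ring

theorem aux_concave : ConcaveOn ℝ Set.univ
    (fun t => Real.log (1 - Real.exp (-Real.exp t))) := by
  apply Antitone.concaveOn_univ_of_deriv
  · exact fun t => (aux_deriv t).differentiableAt
  · intro s t hst
    rw [(aux_deriv s).deriv, (aux_deriv t).deriv]
    exact aux_antitone (Real.exp_pos s) (Real.exp_le_exp.2 hst)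

/-- The key scalar inequality for the exponential kernel (Lemma 3.5):
for all `a, b ≥ 0`,
`exp(-(a+b)) - exp(-a) - exp(-b) ≤ exp(-2√(ab)) - 2·exp(-√(ab))`. -/
theorem exp_kernel_inequality (a b : ℝ) (ha : 0 ≤ a) (hb : 0 ≤ b) :
    Real.exp (-(a + b)) - Real.exp (-a) - Real.exp (-b) ≤
      Real.exp (-(2 * Real.sqrt (a * b))) - 2 * Real.exp (-Real.sqrt (a * b)) := by
  rcases ha.eq_or_lt with rfl | ha
  · simp; norm_num
  rcases hb.eq_or_lt with rfl | hb
  · simp; norm_num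
  obtain ⟨s, rfl⟩ : ∃ s, Real.exp s = a := ⟨_, Real.exp_log ha⟩
  obtain ⟨t, rfl⟩ : ∃ t, Real.exp t = b := ⟨_, Real.exp_log hb⟩
  have hs : Real.sqrt (Real.exp s * Real.exp t) = Real.exp ((1/2) * s + (1/2) * t) := by
    rw [← Real.exp_add, Real.sqrt_eq_iff_mul_self_eq (by positivity) (by positivity),
      ← Real.exp_add]
    ring_nf
  rw [hs]
  have hc := aux_concave.2 (Set.mem_univ s) (Set.mem_univ t)
    (show (0:ℝ) ≤ 1/2 by norm_num) (show (0:ℝ) ≤ 1/2 by norm_num) (by norm_num)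
  simp only [smul_eq_mul] at hc
  set u := (1/2) * s + (1/2) * t
  have hl : Real.log ((1 - Real.exp (-Real.exp s)) * (1 - Real.exp (-Real.exp t)))
      ≤ Real.log ((1 - Real.exp (-Real.exp u)) * (1 - Real.exp (-Real.exp u))) := by
    rw [Real.log_mul (aux_pos s).ne' (aux_pos t).ne', Real.log_mul (aux_pos u).ne' (aux_pos u).ne']
    linarith
  have hl' := (Real.log_le_log_iff (mul_pos (aux_pos s) (aux_pos t))
    (mul_pos (aux_pos u) (aux_pos u))).1 hl
  have e1 : Real.exp (-(Real.exp s + Real.exp t))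
      = Real.exp (-Real.exp s) * Real.exp (-Real.exp t) := by
    rw [← Real.exp_add]; ring_nf
  have e2 : Real.exp (-(2 * Real.exp u))
      = Real.exp (-Real.exp u) * Real.exp (-Real.exp u) := by
    rw [← Real.exp_add]; ring_nf
  rw [e1, e2]
  linarith
end

section
/- Let μ be a (positive) measure on (0,∞) and let f : [0,∞) → ℝ be given by f(x) = ∫_(0,∞) (exp(-x·t) - 1 + x·t)·(1/t) dμ(t), where this integral is finite for every x ≥ 0. Then for all a, b ≥ 0, f(a+b) - f(a) - f(b) ≤ f(2√(ab)) - 2·f(√(ab)). -/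
open MeasureTheory

lemma aux_sub {μ : Measure ℝ} {g h : ℝ → ℝ} (hg : Integrable g μ) (hh : Integrable h μ) :
    Integrable (fun t => g t - h t) μ := hg.sub hh

lemma aux_exp (u v : ℝ) (hv : 0 < v) (hvu : v ≤ u) :
    u * (Real.exp v - 1) ≤ v * (Real.exp u - 1) := by
  have hu : 0 < u := hv.trans_le hvu
  have h := convexOn_exp.2 (Set.mem_univ u) (Set.mem_univ 0)
    (show 0 ≤ v / u by positivity)
    (show 0 ≤ 1 - v / u by rw [sub_nonneg, div_le_one hu]; exact hvu) (by ring)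
  simp only [smul_eq_mul, mul_zero, add_zero, Real.exp_zero, mul_one] at h
  rw [div_mul_cancel₀ _ hu.ne'] at h
  have h2 := mul_le_mul_of_nonneg_left h hu.le
  have h3 : u * (v / u * Real.exp u + (1 - v / u)) = v * Real.exp u + u - v := by
    field_simp
    ring
  rw [h3] at h2
  linarith

lemma aux_anti (s : ℝ) (hs : 0 < s) :
    AntitoneOn (fun r : ℝ => (1 - Real.exp (-(s * r))) * (1 - Real.exp (-(s * r⁻¹))))
      (Set.Ici 1) := by
  have hd : ∀ r : ℝ, 1 ≤ r → HasDerivAt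
      (fun r : ℝ => (1 - Real.exp (-(s * r))) * (1 - Real.exp (-(s * r⁻¹))))
      ((-(Real.exp (-(s * r)) * (-(s * 1)))) * (1 - Real.exp (-(s * r⁻¹))) +
        (1 - Real.exp (-(s * r))) * (-(Real.exp (-(s * r⁻¹)) * (-(s * (-(r ^ 2)⁻¹)))))) r := by
    intro r hr
    have hr0 : r ≠ 0 := by positivity
    exact ((((hasDerivAt_id r).const_mul s).fun_neg.exp).const_sub 1).mul
      ((((hasDerivAt_inv hr0).const_mul s).fun_neg.exp).const_sub 1)
  apply antitoneOn_of_deriv_nonpos (convex_Ici 1)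
  · exact fun r hr => (hd r hr).continuousAt.continuousWithinAt
  · intro r hr
    rw [interior_Ici] at hr
    exact (hd r (le_of_lt hr)).differentiableAt.differentiableWithinAt
  · intro r hr
    rw [interior_Ici] at hr
    have hr1 : 1 < r := hr
    have hr0 : 0 < r := by positivity
    rw [(hd r hr1.le).deriv]
    have hv : 0 < s * r⁻¹ := by positivity
    have hle : s * r⁻¹ ≤ s * r :=
      mul_le_mul_of_nonneg_left ((inv_le_one_of_one_le₀ hr1.le).trans hr1.le) hs.le
    have h := aux_exp (s * r) (s * r⁻¹) hv hle
    have hE := mul_le_mul_of_nonneg_left h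
      (mul_pos (Real.exp_pos (-(s * r))) (Real.exp_pos (-(s * r⁻¹)))).le
    have e1 : Real.exp (-(s * r)) * Real.exp (s * r) = 1 := by rw [← Real.exp_add]; simp
    have e2 : Real.exp (-(s * r⁻¹)) * Real.exp (s * r⁻¹) = 1 := by rw [← Real.exp_add]; simp
    have hri : r * r⁻¹ = 1 := mul_inv_cancel₀ hr0.ne'
    rw [← inv_pow]
    generalize r⁻¹ = q at *
    generalize Real.exp (-(s * r)) = A at *
    generalize Real.exp (-(s * q)) = B at *
    generalize Real.exp (s * r) = A' at *
    generalize Real.exp (s * q) = B' at *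
    have h5 : s * r * A * (1 - B) ≤ s * q * B * (1 - A) := by
      have l : A * B * (s * r * (B' - 1)) = s * r * A * (1 - B) := by
        linear_combination (s * r * A) * e2
      have l2 : A * B * (s * q * (A' - 1)) = s * q * B * (1 - A) := by
        linear_combination (s * q * B) * e1
      linarith
    have hq : 0 < q := by
      by_contra hq
      nlinarith
    have h6 := mul_le_mul_of_nonneg_left h5 hq.le
    have h7 : q * (s * r * A * (1 - B)) = s * A * (1 - B) := by
      linear_combination (s * A * (1 - B)) * hri
    nlinarith

lemma aux_key (u v s : ℝ) (hv : 0 ≤ v) (hvu : v ≤ u) (hs : 0 ≤ s) (h : s ^ 2 = u * v) :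
    (1 - Real.exp (-u)) * (1 - Real.exp (-v)) ≤ (1 - Real.exp (-s)) ^ 2 := by
  rcases hv.eq_or_lt with rfl | hv
  · simp; positivity
  have hu : 0 < u := hv.trans_le hvu
  have hs : 0 < s := by
    rcases hs.eq_or_lt with rfl | hs
    · nlinarith [mul_pos hu hv]
    · exact hs
  have hsu : s ≤ u := by nlinarith
  have h1 : 1 ≤ u / s := by rwa [one_le_div hs]
  have := aux_anti s hs (Set.mem_Ici.2 le_rfl) (Set.mem_Ici.2 h1) h1
  have e1 : s * (u / s) = u := by field_simp
  have e2 : s * (u / s)⁻¹ = v := by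
    field_simp
    linarith
  simp only [e1, e2, inv_one, mul_one] at this
  rw [sq]; exact this

lemma aux_key' (u v s : ℝ) (hu : 0 ≤ u) (hv : 0 ≤ v) (hs : 0 ≤ s) (h : s ^ 2 = u * v) :
    (1 - Real.exp (-u)) * (1 - Real.exp (-v)) ≤ (1 - Real.exp (-s)) ^ 2 := by
  rcases le_total v u with h1 | h1
  · exact aux_key u v s hv h1 hs h
  · rw [mul_comm]; exact aux_key v u s hu h1 hs (by rw [h, mul_comm])

/-- If `f` belongs to the class `BF1`, i.e.
`f x = ∫_(0,∞) (exp(-x·t) - 1 + x·t)·(1/t) dμ(t)` for a positive measure `μ` on `(0,∞)`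
(the integral being finite for every `x ≥ 0`), then for all `a, b ≥ 0`,
`f(a+b) - f(a) - f(b) ≤ f(2√(ab)) - 2·f(√(ab))`. -/
theorem bf1_kernel_inequality (μ : Measure ℝ) (f : ℝ → ℝ)
    (hint : ∀ x ≥ 0,
      IntegrableOn (fun t => (Real.exp (-(x * t)) - 1 + x * t) * (1 / t)) (Set.Ioi 0) μ)
    (hf : ∀ x ≥ 0, f x = ∫ t in Set.Ioi (0 : ℝ), (Real.exp (-(x * t)) - 1 + x * t) * (1 / t) ∂μ)
    (a b : ℝ) (ha : 0 ≤ a) (hb : 0 ≤ b) :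
    f (a + b) - f a - f b ≤ f (2 * Real.sqrt (a * b)) - 2 * f (Real.sqrt (a * b)) := by
  have hs : 0 ≤ Real.sqrt (a * b) := Real.sqrt_nonneg _
  have hss : Real.sqrt (a * b) ^ 2 = a * b := Real.sq_sqrt (mul_nonneg ha hb)
  generalize Real.sqrt (a * b) = s at *
  have hab : 0 ≤ a + b := add_nonneg ha hb
  have h2s : 0 ≤ 2 * s := by positivity
  rw [hf _ hab, hf _ ha, hf _ hb, hf _ h2s, hf _ hs, ← integral_const_mul,
    ← integral_sub (hint _ hab) (hint _ ha),
    ← integral_sub (aux_sub (hint _ hab) (hint _ ha)) (hint _ hb),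
    ← integral_sub (hint _ h2s) ((hint _ hs).const_mul 2)]
  apply setIntegral_mono_on (aux_sub (aux_sub (hint _ hab) (hint _ ha)) (hint _ hb))
    (aux_sub (hint _ h2s) ((hint _ hs).const_mul 2)) measurableSet_Ioi
  intro t ht
  have ht0 : 0 < t := ht
  have hk := aux_key' (a * t) (b * t) (s * t) (by positivity) (by positivity) (by positivity)
    (by rw [mul_pow, hss]; ring)
  have e1 : Real.exp (-((a + b) * t)) = Real.exp (-(a * t)) * Real.exp (-(b * t)) := by
    rw [← Real.exp_add]; congr 1; ring
  have e2 : Real.exp (-(2 * s * t)) = Real.exp (-(s * t)) * Real.exp (-(s * t)) := by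
    rw [← Real.exp_add]; congr 1; ring
  have hm := mul_le_mul_of_nonneg_right hk (one_div_pos.2 ht0).le
  simp only [e1, e2]
  linarith
end

section
/- Let k ≥ 1 be a natural number, let μ be a (positive) measure on (0,∞), and let f : [0,∞) → ℝ be given by f(x) = ∫_(0,∞) (-1)^(k+1)·(exp(-x·t) - Σ_{j=0}^{k} (-x·t)^j/j!)·t^{-k} dμ(t), where this integral is finite for every x ≥ 0. Then f is superadditive on [0,∞): for all x, y ≥ 0, f(x+y) ≥ f(x) + f(y). -/
open MeasureTheory

/-- Signed remainder of the exponential series. -/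
noncomputable def bfG (n : ℕ) (u : ℝ) : ℝ :=
  (-1 : ℝ) ^ n * (Real.exp (-u) - ∑ j ∈ Finset.range n, (-u) ^ j / j.factorial)

theorem bfG_deriv (n : ℕ) (u : ℝ) : HasDerivAt (bfG (n + 1)) (bfG n u) u := by
  have hs : HasDerivAt (fun u : ℝ => ∑ j ∈ Finset.range (n + 1), (-u) ^ j / j.factorial)
      (∑ j ∈ Finset.range (n + 1), ((j : ℝ) * (-u) ^ (j - 1) * (-1)) / j.factorial) u := by
    apply HasDerivAt.fun_sum
    intro j _
    exact (((hasDerivAt_id u).neg).pow j).div_const _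
  have he : HasDerivAt (fun u : ℝ => Real.exp (-u)) (Real.exp (-u) * (-1)) u :=
    ((hasDerivAt_id u).neg).exp
  have h := (he.sub hs).const_mul ((-1 : ℝ) ^ (n + 1))
  refine h.congr_deriv ?_
  have e : (∑ j ∈ Finset.range (n + 1), ((j : ℝ) * (-u) ^ (j - 1) * (-1)) / j.factorial)
      = - ∑ j ∈ Finset.range n, (-u) ^ j / j.factorial := by
    rw [Finset.sum_range_succ', ← Finset.sum_neg_distrib]
    simp only [Nat.cast_zero, zero_mul, zero_div, add_zero]
    refine Finset.sum_congr rfl fun j _ => ?_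
    have h1 : ((j : ℝ) + 1) ≠ 0 := by positivity
    have h2 : (j.factorial : ℝ) ≠ 0 := by positivity
    rw [Nat.factorial_succ]
    push_cast
    field_simp
  rw [e, bfG]
  ring

theorem bfG_zero (n : ℕ) : bfG (n + 1) 0 = 0 := by
  simp [bfG, Finset.sum_range_succ']

theorem bf_mono (g g' : ℝ → ℝ) (h : ∀ u, HasDerivAt g (g' u) u) (h' : ∀ u, 0 ≤ u → 0 ≤ g' u) :
    MonotoneOn g (Set.Ici 0) := by
  apply monotoneOn_of_deriv_nonneg (convex_Ici 0)
  · exact fun u _ => (h u).continuousAt.continuousWithinAt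
  · exact fun u _ => (h u).differentiableAt.differentiableWithinAt
  · intro u hu
    rw [interior_Ici] at hu
    rw [(h u).deriv]
    exact h' u (le_of_lt hu)

theorem bfG_nonneg (n : ℕ) : ∀ u, 0 ≤ u → 0 ≤ bfG n u := by
  induction n with
  | zero => intro u _; simp [bfG]; positivity
  | succ n ih =>
    intro u hu
    have := bf_mono _ _ (bfG_deriv n) ih (Set.mem_Ici.2 le_rfl) (Set.mem_Ici.2 hu) hu
    rwa [bfG_zero] at this

theorem bfG_super (n : ℕ) (a b : ℝ) (ha : 0 ≤ a) (hb : 0 ≤ b) :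
    bfG (n + 2) a + bfG (n + 2) b ≤ bfG (n + 2) (a + b) := by
  have hd : ∀ u, HasDerivAt (fun u => bfG (n + 2) (a + u) - bfG (n + 2) u)
      (bfG (n + 1) (a + u) - bfG (n + 1) u) u := fun u =>
    ((bfG_deriv (n + 1) (a + u)).comp_const_add a u).sub (bfG_deriv (n + 1) u)
  have := bf_mono _ _ hd (fun u hu => sub_nonneg.2
    (bf_mono _ _ (bfG_deriv n) (bfG_nonneg n) (Set.mem_Ici.2 hu)
      (Set.mem_Ici.2 (by linarith)) (by linarith))) (Set.mem_Ici.2 le_rfl) (Set.mem_Ici.2 hb) hb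
  have h0 := bfG_zero (n + 1)
  simp only [add_zero] at this
  linarith


/-- For `k ≥ 1`, a function in the class `BFk` (the `k`-fold iterated integrals of bare
Bernstein functions), i.e.
`f x = ∫_(0,∞) (-1)^(k+1)·(exp(-x·t) - Σ_{j=0}^{k} (-x·t)^j/j!)·t^(-k) dμ(t)` for a positive
measure `μ` on `(0,∞)` (the integral being finite for every `x ≥ 0`), is superadditive
on `[0,∞)`. -/
theorem bfk_superadditive (k : ℕ) (hk : 1 ≤ k) (μ : Measure ℝ) (f : ℝ → ℝ)
    (hint : ∀ x ≥ 0,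
      IntegrableOn
        (fun t => (-1 : ℝ) ^ (k + 1) *
          (Real.exp (-(x * t)) - ∑ j ∈ Finset.range (k + 1), (-(x * t)) ^ j / j.factorial) /
            t ^ k)
        (Set.Ioi 0) μ)
    (hf : ∀ x ≥ 0, f x = ∫ t in Set.Ioi (0 : ℝ),
      (-1 : ℝ) ^ (k + 1) *
        (Real.exp (-(x * t)) - ∑ j ∈ Finset.range (k + 1), (-(x * t)) ^ j / j.factorial) /
          t ^ k ∂μ)
    (x y : ℝ) (hx : 0 ≤ x) (hy : 0 ≤ y) :
    f (x + y) ≥ f x + f y := by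
  rw [hf x hx, hf y hy, hf (x + y) (add_nonneg hx hy), ge_iff_le,
    ← integral_add (hint x hx) (hint y hy)]
  refine setIntegral_mono_on ((hint x hx).add (hint y hy)) (hint _ (add_nonneg hx hy))
    measurableSet_Ioi ?_
  intro t ht
  have ht : 0 < t := ht
  obtain ⟨n, rfl⟩ := Nat.exists_eq_add_of_le' hk
  have h := bfG_super n (x * t) (y * t) (by positivity) (by positivity)
  rw [← add_mul] at h
  rw [← add_div]
  exact div_le_div_of_nonneg_right h (by positivity)
end

section
/- Let A and B be positive semidefinite n×n complex matrices, let (a_k) and (b_l) be their eigenvalues (with multiplicity), and let (u_k) and (v_l) be corresponding orthonormal bases of eigenvectors, so that A = Σ_k a_k·u_k u_kᴴ and B = Σ_l b_l·v_l v_lᴴ. Let μ be a (positive) measure on (0,∞) and let g : [0,∞) → ℝ be given by g(x) = ∫_(0,∞) (exp(-x·t) - 1 + x·t)·(1/t) dμ(t), where this integral is finite for every x ≥ 0. Then Tr(g(A+B)) - Tr(g(A)) - Tr(g(B)) ≤ Σ_{k,l} (g(2√(a_k·b_l)) - 2·g(√(a_k·b_l)))·|⟨u_k, v_l⟩|²,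 where g is applied to a positive semidefinite matrix via the continuous functional calculus (i.e., by applying g to the eigenvalues in a spectral decomposition). -/
open MeasureTheory ComplexOrder Matrix

section GT
variable {n : ℕ}

lemma gt_base (Z : Matrix (Fin n) (Fin n) ℂ) : (Z * Z).trace.re ≤ (Z * Zᴴ).trace.re := by
  have h : 0 ≤ ((Z - Zᴴ) * (Z - Zᴴ)ᴴ).trace :=
    (Matrix.posSemidef_self_mul_conjTranspose (Z - Zᴴ)).trace_nonneg
  have h' := (Complex.le_def.1 h).1
  have e1 : (Zᴴ * Zᴴ).trace.re = (Z * Z).trace.re := by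
    rw [← Matrix.conjTranspose_mul, Matrix.trace_conjTranspose]; simp
  have e2 : (Zᴴ * Z).trace = (Z * Zᴴ).trace := Matrix.trace_mul_comm _ _
  simp only [Matrix.conjTranspose_sub, Matrix.conjTranspose_conjTranspose, Matrix.mul_sub,
    Matrix.sub_mul, Matrix.trace_sub, Complex.sub_re, e1, e2, Complex.zero_re] at h'
  linarith

lemma pow_cyc (X Y : Matrix (Fin n) (Fin n) ℂ) (m : ℕ) :
    ((X * Y) ^ m).trace = ((Y * X) ^ m).trace := by
  cases m with
  | zero => simp
  | succ m =>
    have : ∀ k : ℕ, (X * Y) ^ k * X = X * (Y * X) ^ k := by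
      intro k
      induction k with
      | zero => simp
      | succ k ih =>
        rw [pow_succ', pow_succ', Matrix.mul_assoc, ih]; simp only [Matrix.mul_assoc]
    rw [pow_succ, ← Matrix.mul_assoc, this, Matrix.trace_mul_comm, ← Matrix.mul_assoc, ← pow_succ']

lemma gt_cs (P Q : Matrix (Fin n) (Fin n) ℂ) (hP : P.IsHermitian) (hQ : Q.IsHermitian) :
    2 * (P * Q).trace.re ≤ (P * P).trace.re + (Q * Q).trace.re := by
  have h : 0 ≤ ((P - Q) * (P - Q)ᴴ).trace :=
    (Matrix.posSemidef_self_mul_conjTranspose (P - Q)).trace_nonneg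
  have h' := (Complex.le_def.1 h).1
  have e2 : (Q * P).trace = (P * Q).trace := Matrix.trace_mul_comm _ _
  simp only [Matrix.conjTranspose_sub, hP.eq, hQ.eq, Matrix.mul_sub,
    Matrix.sub_mul, Matrix.trace_sub, Complex.sub_re, e2, Complex.zero_re] at h'
  linarith

lemma gt_ind (k : ℕ) :
    (∀ X Y : Matrix (Fin n) (Fin n) ℂ, X.IsHermitian → Y.IsHermitian →
      ((X * Y) ^ (2 ^ k)).trace.re ≤ (X ^ (2 ^ k) * Y ^ (2 ^ k)).trace.re) ∧
    (∀ Z : Matrix (Fin n) (Fin n) ℂ,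
      ((Z ^ 2) ^ (2 ^ k)).trace.re ≤ ((Z * Zᴴ) ^ (2 ^ k)).trace.re) := by
  induction k with
  | zero =>
    refine ⟨fun X Y _ _ => by simp, fun Z => ?_⟩
    simpa [pow_two] using gt_base Z
  | succ k ih =>
    obtain ⟨hP, hQ⟩ := ih
    refine ⟨fun X Y hX hY => ?_, fun Z => ?_⟩
    · have h1 := hQ (X * Y)
      have h2 := hP (X ^ 2) (Y ^ 2) (hX.pow 2) (hY.pow 2)
      rw [Matrix.conjTranspose_mul, hX.eq, hY.eq] at h1
      have e : X * Y * (Y * X) = X * (Y ^ 2 * X) := by simp only [pow_two, Matrix.mul_assoc]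
      have e' : Y ^ 2 * X * X = Y ^ 2 * X ^ 2 := by simp only [pow_two, Matrix.mul_assoc]
      rw [e, pow_cyc, e', pow_cyc] at h1
      simp only [← pow_mul] at h1 h2 ⊢
      rw [pow_succ']
      exact h1.trans h2
    · have h1 := hQ (Z ^ 2)
      have hp := Matrix.isHermitian_conjTranspose_mul_self Z
      have hq := Matrix.isHermitian_mul_conjTranspose_self Z
      have h2 := hP (Zᴴ * Z) (Z * Zᴴ) hp hq
      have h3 := gt_cs _ _ (hp.pow (2 ^ k)) (hq.pow (2 ^ k))
      have e : Z ^ 2 * (Z ^ 2)ᴴ = Z * (Z * Zᴴ * Zᴴ) := by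
        simp only [pow_two, Matrix.mul_assoc, Matrix.conjTranspose_mul]
      have e' : Z * Zᴴ * Zᴴ * Z = (Z * Zᴴ) * (Zᴴ * Z) := by simp only [Matrix.mul_assoc]
      rw [e, pow_cyc, e', pow_cyc] at h1
      simp only [← pow_add, ← two_mul, ← pow_succ'] at h3
      rw [pow_cyc Zᴴ Z] at h3
      have : (Z ^ 2) ^ 2 ^ (k + 1) = ((Z ^ 2) ^ 2) ^ 2 ^ k := by
        rw [pow_succ' 2 k, pow_mul]
      rw [this]
      linarith

end GT

lemma exp_slope {s r : ℝ} (hs : 0 < s) (hsr : s ≤ r) :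
    r / (Real.exp r - 1) ≤ s / (Real.exp s - 1) := by
  have h := convexOn_exp.secant_mono (a := 0) (x := s) (y := r) (Set.mem_univ _) (Set.mem_univ _)
    (Set.mem_univ _) hs.ne' (hs.trans_le hsr).ne' hsr
  simp only [Real.exp_zero, sub_zero] at h
  have h1 : 0 < (Real.exp s - 1) / s := div_pos (by simpa using hs) hs
  have := inv_anti₀ h1 h
  simpa [inv_div] using this

lemma log_concave_aux : ConcaveOn ℝ Set.univ (fun x : ℝ => Real.log (1 - Real.exp (-Real.exp x))) := by
  have hd : ∀ x : ℝ, HasDerivAt (fun x : ℝ => Real.log (1 - Real.exp (-Real.exp x)))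
      (Real.exp x / (Real.exp (Real.exp x) - 1)) x := by
    intro x
    have hpos : 0 < 1 - Real.exp (-Real.exp x) := by
      simpa using Real.exp_pos x
    have h := ((((Real.hasDerivAt_exp x).neg).exp).const_sub 1).log hpos.ne'
    refine h.congr_deriv ?_
    simp only [Pi.neg_apply]
    have h2 : 0 < Real.exp (Real.exp x) - 1 := by simpa using Real.exp_pos x
    have e : Real.exp (-Real.exp x) * Real.exp (Real.exp x) = 1 := by
      rw [← Real.exp_add]; simp
    rw [div_eq_div_iff hpos.ne' h2.ne']
    linear_combination (Real.exp x) * e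
  refine Antitone.concaveOn_univ_of_deriv (fun x => (hd x).differentiableAt) ?_
  intro x y hxy
  rw [(hd x).deriv, (hd y).deriv]
  exact exp_slope (Real.exp_pos x) (Real.exp_le_exp.2 hxy)

lemma scalar_ineq {a b : ℝ} (ha : 0 ≤ a) (hb : 0 ≤ b) :
    (1 - Real.exp (-a)) * (1 - Real.exp (-b)) ≤ (1 - Real.exp (-√(a * b))) ^ 2 := by
  rcases ha.eq_or_lt with rfl | ha
  · simp
  rcases hb.eq_or_lt with rfl | hb
  · simp
  have key : ∀ x : ℝ, 0 < x → 0 < 1 - Real.exp (-x) := fun x hx => by simpa using hx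
  have h := log_concave_aux.2 (Set.mem_univ (Real.log a)) (Set.mem_univ (Real.log b))
    (show (0 : ℝ) ≤ 1 / 2 by norm_num) (show (0 : ℝ) ≤ 1 / 2 by norm_num) (by norm_num)
  have hs : Real.exp ((1/2 : ℝ) • Real.log a + (1/2 : ℝ) • Real.log b) = √(a * b) := by
    rw [← Real.exp_log (Real.sqrt_pos.2 (mul_pos ha hb)), Real.log_sqrt (mul_pos ha hb).le,
      Real.log_mul ha.ne' hb.ne']
    congr 1
    simp only [smul_eq_mul]; ring
  simp only [smul_eq_mul] at hs
  simp only [Real.exp_log ha, Real.exp_log hb, smul_eq_mul] at h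
  rw [hs] at h
  have hc := key _ (Real.sqrt_pos.2 (mul_pos ha hb))
  rw [← Real.log_le_log_iff (mul_pos (key a ha) (key b hb)) (by positivity),
    Real.log_mul (key a ha).ne' (key b hb).ne', Real.log_pow]
  push_cast
  linarith

lemma norm_pow_sub_pow_aux {R : Type*} [NormedRing R] [NormOneClass R] (X Y : R) (M : ℝ)
    (hM : 1 ≤ M) (hX : ‖X‖ ≤ M) (hY : ‖Y‖ ≤ M) (N : ℕ) :
    ‖X ^ N - Y ^ N‖ ≤ N * ‖X - Y‖ * M ^ N := by
  induction N with
  | zero => simp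
  | succ N ih =>
    have e : X ^ (N + 1) - Y ^ (N + 1) = X ^ N * (X - Y) + (X ^ N - Y ^ N) * Y := by
      rw [pow_succ, pow_succ]; noncomm_ring
    have hXN : ‖X ^ N‖ ≤ M ^ N := (norm_pow_le X N).trans (by gcongr)
    have hMN : M ^ N ≤ M ^ (N + 1) := pow_le_pow_right₀ hM (Nat.le_succ N)
    rw [e]
    calc _ ≤ ‖X ^ N‖ * ‖X - Y‖ + ‖X ^ N - Y ^ N‖ * ‖Y‖ :=
          (norm_add_le _ _).trans (add_le_add (norm_mul_le _ _) (norm_mul_le _ _))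
      _ ≤ M ^ (N + 1) * ‖X - Y‖ + (N * ‖X - Y‖ * M ^ N) * M := by
          gcongr
          exact hXN.trans hMN
      _ = _ := by push_cast; ring

open Filter Topology in
lemma chernoff_aux {R : Type*} [NormedRing R] [NormOneClass R] [NormedAlgebra ℝ R]
    (f g : ℝ → R) (D : R) (hf : HasDerivAt f D 0) (hg : HasDerivAt g D 0)
    (hf0 : f 0 = 1) (hg0 : g 0 = 1) :
    Tendsto (fun N : ℕ => f (N : ℝ)⁻¹ ^ N - g (N : ℝ)⁻¹ ^ N) atTop (𝓝 0) := by
  have hlim : Tendsto (fun N : ℕ => (N : ℝ)⁻¹) atTop (𝓝 0) := tendsto_inv_atTop_nhds_zero_nat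
  have bd : ∀ f : ℝ → R, HasDerivAt f D 0 → f 0 = 1 →
      ∀ᶠ N : ℕ in atTop, ‖f (N : ℝ)⁻¹‖ ≤ Real.exp ((‖D‖ + 1) * (N : ℝ)⁻¹) := by
    intro f hf hf0
    have h := hlim.eventually ((hasDerivAt_iff_isLittleO.1 hf).bound zero_lt_one)
    filter_upwards [h] with N hN
    have hp : (0 : ℝ) ≤ (N : ℝ)⁻¹ := by positivity
    rw [hf0, sub_zero, one_mul, Real.norm_of_nonneg hp] at hN
    have e : f (N : ℝ)⁻¹ = (f (N : ℝ)⁻¹ - 1 - (N : ℝ)⁻¹ • D) + 1 + (N : ℝ)⁻¹ • D := by abel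
    have h1 : ‖f (N : ℝ)⁻¹‖ ≤ (N : ℝ)⁻¹ + 1 + (N : ℝ)⁻¹ * ‖D‖ := by
      rw [e]
      refine (norm_add_le _ _).trans (add_le_add ((norm_add_le _ _).trans
        (add_le_add hN norm_one.le)) ?_)
      rw [norm_smul, Real.norm_of_nonneg hp]
    refine h1.trans ?_
    have := Real.add_one_le_exp ((‖D‖ + 1) * (N : ℝ)⁻¹)
    linarith
  have hd : Tendsto (fun N : ℕ => Real.exp (‖D‖ + 1) * (N * ‖f (N : ℝ)⁻¹ - g (N : ℝ)⁻¹‖))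
      atTop (𝓝 0) := by
    rw [← mul_zero (Real.exp (‖D‖ + 1))]
    refine Tendsto.const_mul _ ?_
    have h := (hf.sub hg)
    rw [sub_self] at h
    have h' := (hasDerivAt_iff_isLittleO.1 h).comp_tendsto hlim
    have h2 := h'.norm_left.tendsto_div_nhds_zero
    refine h2.congr' ?_
    filter_upwards with N
    simp [hf0, hg0, div_eq_mul_inv, mul_comm]
  refine squeeze_zero_norm' ?_ hd
  filter_upwards [bd f hf hf0, bd g hg hg0, eventually_gt_atTop 0] with N h1 h2 hN
  refine (norm_pow_sub_pow_aux _ _ _ (Real.one_le_exp (by positivity)) h1 h2 N).trans ?_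
  rw [← Real.exp_nat_mul]
  have : (N : ℝ) * ((‖D‖ + 1) * (N : ℝ)⁻¹) = ‖D‖ + 1 := by
    have : (N : ℝ) ≠ 0 := by positivity
    field_simp
  rw [this, mul_comm]

open scoped Matrix.Norms.Operator in
open Filter Topology NormedSpace in
lemma trotter {n : ℕ} [Nonempty (Fin n)] (A B : Matrix (Fin n) (Fin n) ℂ) :
    Tendsto (fun N : ℕ => (exp ((N : ℝ)⁻¹ • A) * exp ((N : ℝ)⁻¹ • B)) ^ N) atTop
      (𝓝 (exp (A + B))) := by
  have hA := hasDerivAt_exp_smul_const (𝕂 := ℝ) A 0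
  have hB := hasDerivAt_exp_smul_const (𝕂 := ℝ) B 0
  have hAB := hasDerivAt_exp_smul_const (𝕂 := ℝ) (A + B) 0
  have hmul := hA.mul hB
  simp only [zero_smul, exp_zero, one_mul, mul_one] at hAB hmul
  have h := chernoff_aux _ _ _ hmul hAB (by simp) (by simp)
  have h2 := h.add_const (exp (A + B))
  rw [zero_add] at h2
  refine h2.congr' ?_
  filter_upwards [eventually_gt_atTop 0] with N hN
  have : exp (A + B) = exp ((N : ℝ)⁻¹ • (A + B)) ^ N := by
    rw [← Matrix.exp_nsmul, ← Nat.cast_smul_eq_nsmul ℝ, smul_smul, mul_inv_cancel₀ (by positivity),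
      one_smul]
  rw [this]
  exact sub_add_cancel _ _

open Filter Topology NormedSpace in
lemma golden_thompson {n : ℕ} [Nonempty (Fin n)] (A B : Matrix (Fin n) (Fin n) ℂ)
    (hA : A.IsHermitian) (hB : B.IsHermitian) :
    (exp (A + B)).trace.re ≤ (exp A * exp B).trace.re := by
  have h := (trotter A B).comp (tendsto_pow_atTop_atTop_of_one_lt (one_lt_two (α := ℕ)))
  have hc : Continuous (fun M : Matrix (Fin n) (Fin n) ℂ => M.trace.re) := by fun_prop
  refine le_of_tendsto ((hc.tendsto _).comp h) ?_
  filter_upwards with k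
  have hs : ∀ C : Matrix (Fin n) (Fin n) ℂ, C.IsHermitian →
      (exp (((2 ^ k : ℕ) : ℝ)⁻¹ • C)).IsHermitian ∧
        exp (((2 ^ k : ℕ) : ℝ)⁻¹ • C) ^ (2 ^ k) = exp C := by
    intro C hC
    constructor
    · exact (hC.smul (IsSelfAdjoint.all _)).exp
    · rw [← Matrix.exp_nsmul, ← Nat.cast_smul_eq_nsmul ℝ, smul_smul,
        mul_inv_cancel₀ (by positivity), one_smul]
  have := (gt_ind k).1 _ _ (hs A hA).1 (hs B hB).1
  rw [(hs A hA).2, (hs B hB).2] at this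
  exact this

lemma dec_unitary {n : ℕ} (u : Fin n → (Fin n → ℂ))
    (hu : ∀ k l, star (u k) ⬝ᵥ u l = if k = l then 1 else 0) :
    (Matrix.of fun i k => u k i)ᴴ * (Matrix.of fun i k => u k i) = 1 := by
  ext k l
  have := hu k l
  simp only [dotProduct, Pi.star_apply] at this
  simp [Matrix.mul_apply, Matrix.one_apply, ← this]

lemma dec_eq {n : ℕ} (a : Fin n → ℝ) (u : Fin n → (Fin n → ℂ)) :
    ∑ k, (a k : ℂ) • Matrix.vecMulVec (u k) (star (u k)) =
      (Matrix.of fun i k => u k i) * Matrix.diagonal (fun k => (a k : ℂ)) *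
        (Matrix.of fun i k => u k i)ᴴ := by
  ext i j
  rw [Matrix.mul_apply]
  simp only [Matrix.sum_apply, Matrix.smul_apply, Matrix.vecMulVec_apply,
    Matrix.mul_diagonal, Matrix.of_apply, Matrix.conjTranspose_apply, Pi.star_apply, smul_eq_mul]
  exact Finset.sum_congr rfl fun k _ => by ring

lemma trace_cfc_eig {n : ℕ} (A : Matrix (Fin n) (Fin n) ℂ) (hA : A.IsHermitian) (g : ℝ → ℝ) :
    (cfc g A).trace = ((∑ i, g (hA.eigenvalues i) : ℝ) : ℂ) := by
  rw [hA.cfc_eq, Matrix.IsHermitian.cfc, Unitary.conjStarAlgAut_apply, Matrix.trace_mul_comm,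
    ← Matrix.mul_assoc]
  simp [Matrix.trace_diagonal]

lemma sum_eig {n : ℕ} (A U : Matrix (Fin n) (Fin n) ℂ) (hA : A.IsHermitian) (a : Fin n → ℝ)
    (hU : Uᴴ * U = 1) (h : A = U * Matrix.diagonal (fun k => (a k : ℂ)) * Uᴴ) (g : ℝ → ℝ) :
    ∑ i, g (hA.eigenvalues i) = ∑ k, g (a k) := by
  have h1 : A.charpoly = ∏ k, (Polynomial.X - Polynomial.C (a k : ℂ)) := by
    rw [h, Matrix.charpoly_mul_comm, ← Matrix.mul_assoc, hU, Matrix.one_mul,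
      Matrix.charpoly_diagonal]
  have h2 := hA.roots_charpoly_eq_eigenvalues
  rw [h1, Polynomial.roots_prod _ _ (Finset.prod_ne_zero_iff.2 fun k _ =>
    Polynomial.X_sub_C_ne_zero _)] at h2
  simp only [Polynomial.roots_X_sub_C, Multiset.bind_singleton] at h2
  have h3 := congrArg (fun s => (s.map (fun z : ℂ => g z.re)).sum) h2
  simp only [Multiset.map_map, Function.comp_def] at h3
  exact h3.symm

open NormedSpace in
lemma exp_dec {n : ℕ} (A U : Matrix (Fin n) (Fin n) ℂ) (a : Fin n → ℝ)
    (hU : Uᴴ * U = 1) (h : A = U * Matrix.diagonal (fun k => (a k : ℂ)) * Uᴴ) (t : ℝ) :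
    exp ((-t) • A) = U * Matrix.diagonal (fun k => (Real.exp (-(a k * t)) : ℂ)) * Uᴴ := by
  have hinv : U⁻¹ = Uᴴ := Matrix.inv_eq_left_inv hU
  have hunit : IsUnit U := IsUnit.of_mul_eq_one _ (mul_eq_one_comm.1 hU)
  have e : (-t) • A = U * Matrix.diagonal (fun k => (-(a k * t) : ℂ)) * U⁻¹ := by
    rw [h, hinv, ← Matrix.smul_mul, ← Matrix.mul_smul]
    congr 2
    ext i j
    by_cases hij : i = j
    · subst hij; simp [mul_comm]
    · simp [hij]
  rw [e, Matrix.exp_conj _ _ hunit, Matrix.exp_diagonal, hinv]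
  congr 3
  ext k
  rw [Pi.coe_exp]
  simp [← Complex.exp_eq_exp_ℂ]

lemma trace_two {n : ℕ} (U V : Matrix (Fin n) (Fin n) ℂ) (x y : Fin n → ℝ) :
    ((U * Matrix.diagonal (fun k => (x k : ℂ)) * Uᴴ) *
      (V * Matrix.diagonal (fun k => (y k : ℂ)) * Vᴴ)).trace =
      ((∑ k, ∑ l, x k * y l * ‖(Uᴴ * V) k l‖ ^ 2 : ℝ) : ℂ) := by
  have e : ((U * Matrix.diagonal (fun k => (x k : ℂ)) * Uᴴ) *
      (V * Matrix.diagonal (fun k => (y k : ℂ)) * Vᴴ)).trace =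
      ((Matrix.diagonal (fun k => (x k : ℂ)) * (Uᴴ * V)) *
        (Matrix.diagonal (fun k => (y k : ℂ)) * (Uᴴ * V)ᴴ)).trace := by
    rw [Matrix.mul_assoc U, Matrix.mul_assoc U, Matrix.trace_mul_comm U]
    simp only [Matrix.conjTranspose_mul, Matrix.conjTranspose_conjTranspose, Matrix.mul_assoc]
  rw [e]
  generalize Uᴴ * V = W
  simp only [Matrix.trace, Matrix.diag_apply, Matrix.mul_apply (M := _ * W), Matrix.diagonal_mul,
    Matrix.conjTranspose_apply]
  push_cast
  refine Finset.sum_congr rfl fun k _ => Finset.sum_congr rfl fun l _ => ?_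
  have := Complex.mul_conj' (W k l)
  rw [← this, ← starRingEnd_apply]
  ring

lemma key_ineq {n : ℕ} [Nonempty (Fin n)] (A B U V : Matrix (Fin n) (Fin n) ℂ)
    (hA : A.IsHermitian) (hB : B.IsHermitian) (hAB : (A + B).IsHermitian)
    (a b : Fin n → ℝ) (ha : ∀ k, 0 ≤ a k) (hb : ∀ l, 0 ≤ b l)
    (hU : Uᴴ * U = 1) (hV : Vᴴ * V = 1)
    (hAd : A = U * Matrix.diagonal (fun k => (a k : ℂ)) * Uᴴ)
    (hBd : B = V * Matrix.diagonal (fun k => (b k : ℂ)) * Vᴴ) (t : ℝ) (ht : 0 ≤ t)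
    (φ : ℝ → ℝ) (hφ : ∀ x, φ x = Real.exp (-(x * t)) - 1 + x * t) :
    ∑ i, φ (hAB.eigenvalues i) - ∑ k, φ (a k) - ∑ l, φ (b l) ≤
      ∑ k, ∑ l, (φ (2 * √(a k * b l)) - 2 * φ (√(a k * b l))) * ‖(Uᴴ * V) k l‖ ^ 2 := by
  have hgt := golden_thompson ((-t) • A) ((-t) • B) (hA.smul (IsSelfAdjoint.all _))
    (hB.smul (IsSelfAdjoint.all _))
  rw [← smul_add, exp_dec A U a hU hAd, exp_dec B V b hV hBd, trace_two,
    exp_dec (A + B) _ _ (by simpa [Matrix.star_eq_conjTranspose] using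
      Unitary.coe_star_mul_self hAB.eigenvectorUnitary) (by
      conv_lhs => rw [hAB.spectral_theorem]
      rfl),
    Matrix.trace_mul_comm, ← Matrix.mul_assoc] at hgt
  have hu : (hAB.eigenvectorUnitary : Matrix (Fin n) (Fin n) ℂ)ᴴ * hAB.eigenvectorUnitary = 1 :=
    Unitary.coe_star_mul_self hAB.eigenvectorUnitary
  rw [hu, Matrix.one_mul, Matrix.trace_diagonal, ← Complex.ofReal_sum, Complex.ofReal_re,
    Complex.ofReal_re] at hgt
  simp only [Algebra.algebraMap_self, RingHom.id_apply] at hgt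
  have htr : ∑ i, hAB.eigenvalues i = ∑ k, a k + ∑ l, b l := by
    have h1 := hAB.trace_eq_sum_eigenvalues
    have h2 := hA.trace_eq_sum_eigenvalues
    have h3 := hB.trace_eq_sum_eigenvalues
    have h4 := sum_eig A U hA a hU hAd id
    have h5 := sum_eig B V hB b hV hBd id
    simp only [id] at h4 h5
    rw [Matrix.trace_add, h2, h3] at h1
    rw [← h4, ← h5]
    exact_mod_cast h1.symm
  have hUU := mul_eq_one_comm.1 hU
  have hVV := mul_eq_one_comm.1 hV
  have hone : Matrix.diagonal (fun _ : Fin n => ((1 : ℝ) : ℂ)) = 1 := by simp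
  -- row and column sums through `trace_two`
  have hsum : ∀ x y : Fin n → ℝ, (x = 1 → ∑ k, ∑ l, x k * y l * ‖(Uᴴ * V) k l‖ ^ 2 = ∑ l, y l) ∧
      (y = 1 → ∑ k, ∑ l, x k * y l * ‖(Uᴴ * V) k l‖ ^ 2 = ∑ k, x k) := by
    intro x y
    constructor
    · rintro rfl
      have h := trace_two U V 1 y
      simp only [Pi.one_apply, hone, Matrix.mul_one, hUU, Matrix.one_mul] at h
      rw [Matrix.trace_mul_comm, ← Matrix.mul_assoc, hV, Matrix.one_mul, Matrix.trace_diagonal] at h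
      simp only [Pi.one_apply]
      exact_mod_cast h.symm
    · rintro rfl
      have h := trace_two U V x 1
      simp only [Pi.one_apply, hone, Matrix.mul_one, hVV] at h
      rw [Matrix.trace_mul_comm, ← Matrix.mul_assoc, hU, Matrix.one_mul, Matrix.trace_diagonal] at h
      simp only [Pi.one_apply]
      exact_mod_cast h.symm
  have s1 := (hsum (fun k => Real.exp (-(a k * t))) 1).2 rfl
  have s2 := (hsum 1 (fun k => Real.exp (-(b k * t)))).1 rfl
  have s3 := (hsum 1 1).1 rfl
  have hmain : ∑ k, ∑ l, (1 - Real.exp (-(a k * t))) * (1 - Real.exp (-(b l * t))) *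
      ‖(Uᴴ * V) k l‖ ^ 2 ≤
      ∑ k, ∑ l, (φ (2 * √(a k * b l)) - 2 * φ (√(a k * b l))) * ‖(Uᴴ * V) k l‖ ^ 2 := by
    refine Finset.sum_le_sum fun k _ => Finset.sum_le_sum fun l _ => ?_
    refine mul_le_mul_of_nonneg_right ?_ (by positivity)
    refine (scalar_ineq (mul_nonneg (ha k) ht) (mul_nonneg (hb l) ht)).trans_eq ?_
    have e1 : √(a k * t * (b l * t)) = √(a k * b l) * t := by
      rw [show a k * t * (b l * t) = (a k * b l) * t ^ 2 by ring,
        Real.sqrt_mul (mul_nonneg (ha k) (hb l)), Real.sqrt_sq ht]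
    have e2 : Real.exp (-(2 * √(a k * b l) * t)) = Real.exp (-(√(a k * b l) * t)) ^ 2 := by
      rw [← Real.exp_nat_mul]; congr 1; push_cast; ring
    rw [e1, hφ, hφ, e2]
    ring
  refine le_trans ?_ hmain
  have hexp : ∑ k, ∑ l, (1 - Real.exp (-(a k * t))) * (1 - Real.exp (-(b l * t))) *
      ‖(Uᴴ * V) k l‖ ^ 2 =
      ∑ k, ∑ l, (1 : Fin n → ℝ) k * (1 : Fin n → ℝ) l * ‖(Uᴴ * V) k l‖ ^ 2
      - ∑ k, ∑ l, Real.exp (-(a k * t)) * (1 : Fin n → ℝ) l * ‖(Uᴴ * V) k l‖ ^ 2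
      - ∑ k, ∑ l, (1 : Fin n → ℝ) k * Real.exp (-(b l * t)) * ‖(Uᴴ * V) k l‖ ^ 2
      + ∑ k, ∑ l, Real.exp (-(a k * t)) * Real.exp (-(b l * t)) * ‖(Uᴴ * V) k l‖ ^ 2 := by
    simp only [← Finset.sum_sub_distrib, ← Finset.sum_add_distrib]
    refine Finset.sum_congr rfl fun k _ => Finset.sum_congr rfl fun l _ => ?_
    simp only [Pi.one_apply]; ring
  rw [hexp, s1, s2, s3]
  simp only [hφ, Finset.sum_add_distrib, Finset.sum_sub_distrib, ← Finset.sum_mul, htr,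
    Pi.one_apply]
  linarith

/-- The main trace inequality (Theorem 3.8) for functions in the class `BF1`.
Let `A = Σ_k a_k·u_k u_kᴴ` and `B = Σ_l b_l·v_l v_lᴴ` be spectral decompositions of
positive semidefinite matrices `A` and `B`, and let
`g x = ∫_(0,∞) (exp(-x·t) - 1 + x·t)·(1/t) dμ(t)` for a positive measure `μ` on `(0,∞)`
(the integral being finite for every `x ≥ 0`).  Then
`Tr(g(A+B)) - Tr(g(A)) - Tr(g(B))
  ≤ Σ_{k,l} (g(2√(a_k·b_l)) - 2·g(√(a_k·b_l)))·|⟨u_k, v_l⟩|²`,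
where `g` is applied to matrices via the continuous functional calculus. -/
theorem trace_inequality_bf1 {n : ℕ}
    (A B : Matrix (Fin n) (Fin n) ℂ) (hA : A.PosSemidef) (hB : B.PosSemidef)
    (a b : Fin n → ℝ) (ha : ∀ k, 0 ≤ a k) (hb : ∀ l, 0 ≤ b l)
    (u v : Fin n → (Fin n → ℂ))
    (hu : ∀ k l, star (u k) ⬝ᵥ u l = if k = l then 1 else 0)
    (hv : ∀ k l, star (v k) ⬝ᵥ v l = if k = l then 1 else 0)
    (hAdec : A = ∑ k, (a k : ℂ) • Matrix.vecMulVec (u k) (star (u k)))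
    (hBdec : B = ∑ l, (b l : ℂ) • Matrix.vecMulVec (v l) (star (v l)))
    (μ : Measure ℝ) (g : ℝ → ℝ)
    (hint : ∀ x ≥ 0,
      IntegrableOn (fun t => (Real.exp (-(x * t)) - 1 + x * t) * (1 / t)) (Set.Ioi 0) μ)
    (hg : ∀ x ≥ 0, g x = ∫ t in Set.Ioi (0 : ℝ), (Real.exp (-(x * t)) - 1 + x * t) * (1 / t) ∂μ) :
    (cfc g (A + B)).trace - (cfc g A).trace - (cfc g B).trace ≤
      ((∑ k, ∑ l,
        (g (2 * Real.sqrt (a k * b l)) - 2 * g (Real.sqrt (a k * b l))) *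
          ‖star (u k) ⬝ᵥ v l‖ ^ 2 : ℝ) : ℂ) := by
  rcases isEmpty_or_nonempty (Fin n) with hn | hn
  · simp [Matrix.trace]
  have hAB := hA.add hB
  rw [dec_eq] at hAdec hBdec
  have hU := dec_unitary u hu
  have hV := dec_unitary v hv
  have hW : ∀ k l, star (u k) ⬝ᵥ v l =
      ((Matrix.of fun i k => u k i)ᴴ * (Matrix.of fun i k => v k i)) k l := by
    intro k l
    simp [Matrix.mul_apply, dotProduct]
  simp only [hW]
  generalize (Matrix.of fun i k => u k i) = U at *
  generalize (Matrix.of fun i k => v k i) = V at *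
  rw [trace_cfc_eig _ hAB.isHermitian, trace_cfc_eig _ hA.isHermitian,
    trace_cfc_eig _ hB.isHermitian, sum_eig A U hA.isHermitian a hU hAdec,
    sum_eig B V hB.isHermitian b hV hBdec, ← Complex.ofReal_sub, ← Complex.ofReal_sub,
    Complex.real_le_real]
  have hc : ∀ i, 0 ≤ hAB.isHermitian.eigenvalues i := hAB.eigenvalues_nonneg
  have hG : ∀ x : ℝ, 0 ≤ x → Integrable (fun t => (Real.exp (-(x * t)) - 1 + x * t) * (1 / t))
    (μ.restrict (Set.Ioi 0)) := fun x hx => hint x hx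
  have hs : ∀ k l, 0 ≤ √(a k * b l) := fun k l => Real.sqrt_nonneg _
  have hs2 : ∀ k l, 0 ≤ 2 * √(a k * b l) := fun k l => by positivity
  set ψ : ℝ → ℝ → ℝ := fun x t => (Real.exp (-(x * t)) - 1 + x * t) * (1 / t) with hψ
  set ν := μ.restrict (Set.Ioi (0 : ℝ)) with hν
  have hI : ∀ x, 0 ≤ x → Integrable (ψ x) ν := fun x hx => hint x hx
  have hg' : ∀ x, 0 ≤ x → g x = ∫ t, ψ x t ∂ν := fun x hx => hg x hx
  have i1 : Integrable (fun t => ∑ i, ψ (hAB.isHermitian.eigenvalues i) t) ν :=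
    integrable_finsetSum _ fun i _ => hI _ (hc i)
  have i2 : Integrable (fun t => ∑ k, ψ (a k) t) ν :=
    integrable_finsetSum _ fun i _ => hI _ (ha i)
  have i3 : Integrable (fun t => ∑ l, ψ (b l) t) ν :=
    integrable_finsetSum _ fun i _ => hI _ (hb i)
  have i4 : ∀ k l, Integrable (fun t => (ψ (2 * √(a k * b l)) t - 2 * ψ (√(a k * b l)) t) *
      ‖(Uᴴ * V) k l‖ ^ 2) ν := fun k l =>
    ((hI _ (hs2 k l)).sub ((hI _ (hs k l)).const_mul 2)).mul_const _
  have i5 : ∀ k, Integrable (fun t => ∑ l, (ψ (2 * √(a k * b l)) t - 2 * ψ (√(a k * b l)) t) *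
      ‖(Uᴴ * V) k l‖ ^ 2) ν := fun k => integrable_finsetSum _ fun l _ => i4 k l
  have i6 : Integrable (fun t => ∑ k, ∑ l,
      (ψ (2 * √(a k * b l)) t - 2 * ψ (√(a k * b l)) t) * ‖(Uᴴ * V) k l‖ ^ 2) ν :=
    integrable_finsetSum _ fun k _ => i5 k
  have i12 : Integrable (fun t => ∑ i, ψ (hAB.isHermitian.eigenvalues i) t - ∑ k, ψ (a k) t) ν :=
    i1.sub i2
  have eL : ∑ i, g (hAB.isHermitian.eigenvalues i) - ∑ k, g (a k) - ∑ l, g (b l) =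
      ∫ t, (∑ i, ψ (hAB.isHermitian.eigenvalues i) t - ∑ k, ψ (a k) t - ∑ l, ψ (b l) t) ∂ν := by
    rw [integral_sub i12 i3, integral_sub i1 i2,
      integral_finsetSum _ fun i _ => hI _ (hc i), integral_finsetSum _ fun i _ => hI _ (ha i),
      integral_finsetSum _ fun i _ => hI _ (hb i)]
    simp only [fun i => hg' _ (hc i), fun i => hg' _ (ha i), fun i => hg' _ (hb i)]
  have eR : ∑ k, ∑ l, (g (2 * √(a k * b l)) - 2 * g (√(a k * b l))) * ‖(Uᴴ * V) k l‖ ^ 2 =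
      ∫ t, (∑ k, ∑ l,
        (ψ (2 * √(a k * b l)) t - 2 * ψ (√(a k * b l)) t) * ‖(Uᴴ * V) k l‖ ^ 2) ∂ν := by
    rw [integral_finsetSum _ fun k _ => i5 k]
    refine Finset.sum_congr rfl fun k _ => ?_
    rw [integral_finsetSum _ fun l _ => i4 k l]
    refine Finset.sum_congr rfl fun l _ => ?_
    rw [integral_mul_const, integral_sub (hI _ (hs2 k l)) ((hI _ (hs k l)).const_mul 2),
      integral_const_mul, hg' _ (hs2 k l), hg' _ (hs k l)]
  rw [eL, eR]
  refine integral_mono_ae ((i1.sub i2).sub i3) i6 ?_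
  filter_upwards [ae_restrict_mem measurableSet_Ioi] with t ht
  have ht0 : (0 : ℝ) < t := ht
  have hk := key_ineq A B U V hA.isHermitian hB.isHermitian hAB.isHermitian a b ha hb hU hV
    hAdec hBdec t ht0.le (fun x => Real.exp (-(x * t)) - 1 + x * t) (fun x => rfl)
  have hk' := mul_le_mul_of_nonneg_right hk (one_div_pos.2 ht0).le
  simp only [sub_mul _ _ (1 / t), Finset.sum_mul] at hk'
  refine le_trans (le_of_eq ?_) (hk'.trans (le_of_eq ?_))
  · simp only [hψ, sub_mul, add_mul]
  · refine Finset.sum_congr rfl fun k _ => Finset.sum_congr rfl fun l _ => ?_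
    simp only [hψ]; ring
end

section
/- Let A and B be positive semidefinite n×n complex matrices, let (a_k) and (b_l) be their eigenvalues (with multiplicity), and let (u_k) and (v_l) be corresponding orthonormal bases of eigenvectors, so that A = Σ_k a_k·u_k u_kᴴ and B = Σ_l b_l·v_l v_lᴴ. Let μ be a (positive) measure on (0,∞) and let g : [0,∞) → ℝ be given by g(x) = ∫_(0,∞) ((1 - x·t + x²·t²/2) - exp(-x·t))·(1/t²) dμ(t), where this integral is finite for every x ≥ 0. Then Tr(g(A+B)) - Tr(g(A)) - Tr(g(B)) ≥ Σ_{k,l} (g(2√(a_k·b_l)) - 2·g(√(a_k·b_l)))·|⟨u_k, v_l⟩|², where g is applied to a positive semidefinite matrix via the continuous functional calculus (i.e., by applying g to the eigenvalues in a spectral decomposition). -/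
open MeasureTheory ComplexOrder Matrix

namespace BF2Aux

/-! ### Scalar inequality -/

lemma scalar_pos {a b : ℝ} (ha : 0 < a) (hb : 0 < b) :
    (1 - Real.exp (-a)) * (1 - Real.exp (-b)) ≤ (1 - Real.exp (-Real.sqrt (a * b))) ^ 2 := by
  let F : ℝ → ℝ := fun y => Real.log (1 - Real.exp (-Real.exp y))
  have hpos : ∀ x : ℝ, 0 < x → 0 < 1 - Real.exp (-x) := by
    intro x hx
    have : Real.exp (-x) < 1 := by rw [Real.exp_lt_one_iff]; linarith
    linarith
  have hder : ∀ y, HasDerivAt F (Real.exp y / (Real.exp (Real.exp y) - 1)) y := by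
    intro y
    have h1 : HasDerivAt (fun y => 1 - Real.exp (-Real.exp y))
        (-(Real.exp (-Real.exp y) * (-Real.exp y))) y :=
      (((Real.hasDerivAt_exp y).neg).exp).const_sub 1
    have h2 := h1.log (hpos _ (Real.exp_pos y)).ne'
    convert h2 using 1
    have h3 := hpos _ (Real.exp_pos y)
    have h4 : 1 < Real.exp (Real.exp y) := Real.one_lt_exp_iff.2 (Real.exp_pos y)
    rw [div_eq_div_iff (by linarith) h3.ne', Real.exp_neg]
    field_simp
  have hconc : ConcaveOn ℝ Set.univ F := by
    apply Antitone.concaveOn_univ_of_deriv (fun y => (hder y).differentiableAt)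
    intro y z hyz
    rw [(hder y).deriv, (hder z).deriv]
    have hy := Real.exp_pos y
    have hz := Real.exp_pos z
    have h4 : 1 < Real.exp (Real.exp y) := Real.one_lt_exp_iff.2 hy
    have h5 : 1 < Real.exp (Real.exp z) := Real.one_lt_exp_iff.2 hz
    have hs := convexOn_exp.secant_mono (a := 0) (x := Real.exp y) (y := Real.exp z)
      (Set.mem_univ _) (Set.mem_univ _) (Set.mem_univ _) hy.ne' hz.ne' (Real.exp_le_exp.2 hyz)
    simp only [Real.exp_zero, sub_zero] at hs
    rw [div_le_div_iff₀ hy hz] at hs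
    rw [div_le_div_iff₀ (by linarith) (by linarith)]
    linarith
  have hc := hconc.2 (Set.mem_univ (Real.log a)) (Set.mem_univ (Real.log b))
    (by norm_num : (0:ℝ) ≤ 1/2) (by norm_num : (0:ℝ) ≤ 1/2) (by norm_num)
  have hs : Real.exp ((1/2 : ℝ) • Real.log a + (1/2 : ℝ) • Real.log b) = Real.sqrt (a * b) := by
    rw [smul_eq_mul, smul_eq_mul, ← mul_add, ← Real.log_mul ha.ne' hb.ne', Real.sqrt_eq_rpow,
      Real.rpow_def_of_pos (by positivity), mul_comm]
  simp only [F, hs, Real.exp_log ha, Real.exp_log hb] at hc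
  simp only [smul_eq_mul] at hc
  have hsp := hpos _ (Real.sqrt_pos.2 (mul_pos ha hb))
  rw [← Real.log_le_log_iff (mul_pos (hpos a ha) (hpos b hb)) (by positivity),
    Real.log_mul (hpos a ha).ne' (hpos b hb).ne', Real.log_pow]
  push_cast
  linarith

lemma scalar_ineq {a b : ℝ} (ha : 0 ≤ a) (hb : 0 ≤ b) :
    2 * Real.exp (-Real.sqrt (a * b)) - Real.exp (-(2 * Real.sqrt (a * b))) ≤
      Real.exp (-a) + Real.exp (-b) - Real.exp (-a) * Real.exp (-b) := by
  have key : (1 - Real.exp (-a)) * (1 - Real.exp (-b)) ≤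
      (1 - Real.exp (-Real.sqrt (a * b))) ^ 2 := by
    rcases ha.eq_or_lt with rfl | ha
    · simp
    rcases hb.eq_or_lt with rfl | hb
    · simp
    exact scalar_pos ha hb
  have : Real.exp (-(2 * Real.sqrt (a * b))) = Real.exp (-Real.sqrt (a * b)) ^ 2 := by
    rw [← Real.exp_nat_mul]; congr 1; push_cast; ring
  rw [this]; nlinarith

/-! ### Trace inequalities -/

variable {n : ℕ}

local notation "Mat" n => Matrix (Fin n) (Fin n) ℂ

lemma trace_pow_comm (X Y : Mat n) (m : ℕ) : ((X * Y) ^ m).trace = ((Y * X) ^ m).trace := by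
  cases m with
  | zero => simp
  | succ m =>
    have h : ∀ k, (X * Y) ^ k * X = X * (Y * X) ^ k := by
      intro k
      induction k with
      | zero => simp
      | succ k ih => rw [pow_succ, pow_succ, ← mul_assoc X, ← ih]; simp only [mul_assoc]
    rw [pow_succ, ← mul_assoc, h, Matrix.trace_mul_comm, ← mul_assoc, ← pow_succ']

lemma pair_list (m : ℕ) : ∀ L : List (Mat n), L.length = 2 * m →
    ∃ L' : List (Mat n), L'.length = m ∧ L'.prod = L.prod ∧
      ∀ Y ∈ L', ∃ A ∈ L, ∃ B ∈ L, Y = A * B := by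
  induction m with
  | zero => intro L hL; obtain rfl := List.length_eq_zero_iff.1 (by simpa using hL : L.length = 0)
            exact ⟨[], rfl, rfl, by simp⟩
  | succ m ih =>
    intro L hL
    match L, hL with
    | A :: B :: L, hL =>
      obtain ⟨L', h1, h2, h3⟩ := ih L (by simp at hL; omega)
      refine ⟨(A * B) :: L', by simp [h1], by simp [h2, mul_assoc], ?_⟩
      intro Y hY
      rcases List.mem_cons.1 hY with rfl | hY
      · exact ⟨A, by simp, B, by simp, rfl⟩
      · obtain ⟨A', hA, B', hB, h⟩ := h3 Y hY
        exact ⟨A', by simp [hA], B', by simp [hB], h⟩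

lemma alt_list (P Q : Mat n) (m : ℕ) :
    ∃ L : List (Mat n), L.length = 2 * m ∧ L.prod = (P * Q) ^ m ∧ ∀ Y ∈ L, Y = P ∨ Y = Q := by
  induction m with
  | zero => exact ⟨[], rfl, by simp, by simp⟩
  | succ m ih =>
    obtain ⟨L, h1, h2, h3⟩ := ih
    refine ⟨P :: Q :: L, by simp [h1]; ring, by simp [h2, pow_succ', mul_assoc], ?_⟩
    intro Y hY
    simp only [List.mem_cons] at hY
    rcases hY with h | h | h
    · exact Or.inl h
    · exact Or.inr h
    · exact h3 Y h

lemma trace_mul_conj_re (X : Mat n) : (X * Xᴴ).trace.re = ∑ i, ∑ j, ‖X i j‖ ^ 2 := by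
  simp only [Matrix.trace, Matrix.diag, Matrix.mul_apply, Complex.re_sum, conjTranspose_apply]
  refine Finset.sum_congr rfl fun i _ => Finset.sum_congr rfl fun j _ => ?_
  rw [← Complex.normSq_eq_norm_sq, RCLike.star_def, Complex.mul_conj, Complex.ofReal_re]

lemma cs_bound (X Y : Mat n) (c : ℝ) (hX : ‖(X * Xᴴ).trace‖ ≤ c) (hY : ‖(Y * Yᴴ).trace‖ ≤ c) :
    ‖(X * Y).trace‖ ≤ c := by
  have h1 := (Complex.re_le_norm _).trans hX
  have h2 := (Complex.re_le_norm _).trans hY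
  rw [trace_mul_conj_re] at h1 h2
  rw [Finset.sum_comm] at h2
  have : ‖(X * Y).trace‖ ≤ ∑ i, ∑ j, (‖X i j‖ ^ 2 + ‖Y j i‖ ^ 2) / 2 := by
    simp only [Matrix.trace, Matrix.diag, Matrix.mul_apply]
    refine (norm_sum_le _ _).trans (Finset.sum_le_sum fun i _ => ?_)
    refine (norm_sum_le _ _).trans (Finset.sum_le_sum fun j _ => ?_)
    rw [norm_mul]
    nlinarith [sq_nonneg (‖X i j‖ - ‖Y j i‖)]
  simp only [← Finset.sum_div, Finset.sum_add_distrib] at this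
  linarith

/-- Dyadic Schatten-Hölder inequality. -/
lemma holder (k : ℕ) : ∀ (c : ℝ) (L : List (Mat n)), L.length = 2 ^ (k + 1) →
    (∀ X ∈ L, ‖((X * Xᴴ) ^ (2 ^ k)).trace‖ ≤ c) → ‖L.prod.trace‖ ≤ c := by
  induction k with
  | zero =>
    intro c L hL h
    match L, hL with
    | [X, Y], _ =>
      simp only [List.prod_cons, List.prod_nil, mul_one]
      exact cs_bound X Y c (by simpa using h X (by simp)) (by simpa using h Y (by simp))
  | succ k ih =>
    intro c L hL h
    obtain ⟨L', h1, h2, h3⟩ := pair_list (2 ^ (k + 1)) L (by rw [hL]; ring)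
    rw [← h2]
    apply ih c L' h1
    intro Y hY
    obtain ⟨A, hA, B, hB, rfl⟩ := h3 Y hY
    have e : (A * B * (A * B)ᴴ) = A * (B * Bᴴ * Aᴴ) := by
      simp only [conjTranspose_mul, mul_assoc]
    rw [e, trace_pow_comm]
    have e2 : B * Bᴴ * Aᴴ * A = (B * Bᴴ) * (Aᴴ * A) := by simp only [mul_assoc]
    rw [e2]
    obtain ⟨M, m1, m2, m3⟩ := alt_list (B * Bᴴ) (Aᴴ * A) (2 ^ k)
    rw [← m2]
    apply ih c M (by rw [m1]; ring)
    intro X hX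
    rcases m3 X hX with rfl | rfl
    · have := h B hB
      rw [conjTranspose_mul, conjTranspose_conjTranspose, ← pow_two, ← pow_mul, ← pow_succ']
      exact this
    · have := h A hA
      rw [conjTranspose_mul, conjTranspose_conjTranspose, ← pow_two, ← pow_mul, ← pow_succ',
        trace_pow_comm]
      exact this

lemma gt_dyadic (k : ℕ) : ∀ (P Q : Mat n), P.IsHermitian → Q.IsHermitian →
    ‖((P * Q) ^ (2 ^ k)).trace‖ ≤ ‖(P ^ (2 ^ k) * Q ^ (2 ^ k)).trace‖ := by
  induction k with
  | zero => intro P Q _ _; simp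
  | succ k ih =>
    intro P Q hP hQ
    have hstep : ‖((P * Q) ^ (2 ^ (k + 1))).trace‖ ≤ ‖((P ^ 2 * Q ^ 2) ^ (2 ^ k)).trace‖ := by
      rw [← List.prod_replicate]
      apply holder k _ _ (by simp)
      intro X hX
      obtain rfl := List.eq_of_mem_replicate hX
      rw [conjTranspose_mul, hP.eq, hQ.eq,
        show P * Q * (Q * P) = (P * (Q * Q)) * P by simp only [mul_assoc], trace_pow_comm,
        show P * (P * (Q * Q)) = P ^ 2 * Q ^ 2 by simp only [pow_two, mul_assoc]]
    refine hstep.trans ?_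
    have := ih (P ^ 2) (Q ^ 2) (hP.pow 2) (hQ.pow 2)
    rwa [← pow_mul, ← pow_mul, ← pow_succ'] at this

/-! ### Lie-Trotter -/

section Trotter
open Filter Topology

variable {E : Type*} [NormedRing E] [NormOneClass E]

lemma norm_pow_sub (x y : E) (M : ℝ) (hM : 1 ≤ M) (hx : ‖x‖ ≤ M) (hy : ‖y‖ ≤ M) (m : ℕ) :
    ‖x ^ m - y ^ m‖ ≤ M ^ m * (m * ‖x - y‖) := by
  induction m with
  | zero => simp
  | succ m ih =>
    have e : x ^ (m + 1) - y ^ (m + 1) = x ^ m * (x - y) + (x ^ m - y ^ m) * y := by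
      rw [pow_succ, pow_succ]; noncomm_ring
    have hxm : ‖x ^ m‖ ≤ M ^ m := (norm_pow_le x m).trans (by gcongr)
    have hM0 : 0 ≤ M := by linarith
    calc _ ≤ ‖x ^ m‖ * ‖x - y‖ + ‖x ^ m - y ^ m‖ * ‖y‖ := by
          rw [e]; exact (norm_add_le _ _).trans (add_le_add (norm_mul_le _ _) (norm_mul_le _ _))
      _ ≤ M ^ m * M * ‖x - y‖ + (M ^ m * (m * ‖x - y‖)) * M := by
          gcongr
          refine hxm.trans (le_mul_of_one_le_right (by positivity) hM)
      _ = _ := by push_cast; ring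

lemma trotter_aux [NormedAlgebra ℝ E] (f g : ℝ → E) (D : E) (hf : HasDerivAt f D 0) (hg : HasDerivAt g D 0)
    (f0 : f 0 = 1) (g0 : g 0 = 1) :
    Tendsto (fun k : ℕ => f ((2 ^ k : ℝ)⁻¹) ^ (2 ^ k) - g ((2 ^ k : ℝ)⁻¹) ^ (2 ^ k)) atTop (𝓝 0) := by
  have ht : Tendsto (fun k : ℕ => ((2 ^ k : ℝ)⁻¹)) atTop (𝓝[≠] 0) := by
    rw [tendsto_nhdsWithin_iff]
    refine ⟨?_, Eventually.of_forall fun k => by simp⟩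
    have := tendsto_pow_atTop_nhds_zero_of_lt_one (r := (1/2 : ℝ)) (by norm_num) (by norm_num)
    simpa using this
  have key : ∀ h : ℝ → E, ∀ D : E, HasDerivAt h D 0 →
      Tendsto (fun k : ℕ => (2 ^ k : ℝ) * ‖h ((2 ^ k : ℝ)⁻¹) - h 0‖) atTop (𝓝 ‖D‖) := by
    intro h D hh
    have := ((hasDerivAt_iff_tendsto_slope_zero.1 hh).comp ht).norm
    refine this.congr fun k => ?_
    simp [norm_smul]
  have hbd : ∀ h : ℝ → E, HasDerivAt h D 0 → h 0 = 1 →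
      ∀ᶠ k : ℕ in atTop, ‖h ((2 ^ k : ℝ)⁻¹)‖ ≤ Real.exp ((‖D‖ + 1) * (2 ^ k : ℝ)⁻¹) := by
    intro h hh h0
    filter_upwards [(key h D hh).eventually_lt_const (lt_add_one ‖D‖)] with k hk
    have h2 : (0:ℝ) < 2 ^ k := by positivity
    have h3 : ‖h ((2 ^ k : ℝ)⁻¹) - h 0‖ ≤ (‖D‖ + 1) * (2 ^ k : ℝ)⁻¹ := by
      rw [← div_eq_mul_inv, le_div_iff₀ h2]; linarith
    have h4 : ‖h ((2 ^ k : ℝ)⁻¹)‖ ≤ ‖h ((2 ^ k : ℝ)⁻¹) - h 0‖ + 1 := by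
      have := norm_add_le (h ((2 ^ k : ℝ)⁻¹) - h 0) (h 0)
      rw [sub_add_cancel] at this
      simpa [h0] using this
    have := Real.add_one_le_exp ((‖D‖ + 1) * (2 ^ k : ℝ)⁻¹)
    linarith
  have hdiff := key (fun t => f t - g t) (D - D) (hf.sub hg)
  simp only [sub_self, norm_zero, f0, g0, sub_zero] at hdiff
  apply squeeze_zero_norm' (a := fun k : ℕ => Real.exp (‖D‖ + 1) *
    ((2 ^ k : ℝ) * ‖f ((2 ^ k : ℝ)⁻¹) - g ((2 ^ k : ℝ)⁻¹)‖))
  · filter_upwards [hbd f hf f0, hbd g hg g0] with k hk1 hk2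
    have := norm_pow_sub _ _ _ (Real.one_le_exp (by positivity)) hk1 hk2 (2 ^ k)
    rw [← Real.exp_nat_mul] at this
    have e : ((2 ^ k : ℕ) : ℝ) * ((‖D‖ + 1) * (2 ^ k : ℝ)⁻¹) = ‖D‖ + 1 := by
      push_cast; field_simp
    rw [e] at this
    push_cast at this
    exact this
  · simpa using hdiff.const_mul (Real.exp (‖D‖ + 1))

lemma trotter [NormedAlgebra ℝ E] [CompleteSpace E] (X Y : E) :
    Tendsto (fun k : ℕ => (NormedSpace.exp ((2 ^ k : ℝ)⁻¹ • X) *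
      NormedSpace.exp ((2 ^ k : ℝ)⁻¹ • Y)) ^ (2 ^ k)) atTop (𝓝 (NormedSpace.exp (X + Y))) := by
  let +nondep : NormedAlgebra ℚ E := .restrictScalars ℚ ℝ E
  have hd : ∀ Z : E, HasDerivAt (fun t : ℝ => NormedSpace.exp (t • Z)) Z 0 := by
    intro Z
    simpa using hasDerivAt_exp_smul_const (𝕂 := ℝ) Z (0:ℝ)
  have h1 : HasDerivAt (fun t : ℝ => NormedSpace.exp (t • X) * NormedSpace.exp (t • Y))
      (X + Y) 0 := by
    simpa using! (hd X).mul (hd Y)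
  have hlim := trotter_aux _ _ _ h1 (hd (X + Y)) (by simp) (by simp)
  have hpow : ∀ (Z : E) (k : ℕ), NormedSpace.exp (((2 ^ k : ℝ)⁻¹) • Z) ^ (2 ^ k) =
      NormedSpace.exp Z := by
    intro Z k
    rw [← NormedSpace.exp_nsmul]
    congr 1
    rw [← Nat.cast_smul_eq_nsmul ℝ, smul_smul]
    simp
  simp only [hpow] at hlim
  have hlim2 := hlim.add_const (NormedSpace.exp (X + Y))
  simpa only [sub_add_cancel, zero_add] using hlim2

end Trotter

section GT
open Filter Topology NormedSpace

attribute [local instance] Matrix.linftyOpNormedRing Matrix.linftyOpNormedAlgebra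

lemma matrix_trotter (hn : 0 < n) (X Y : Mat n) :
    Tendsto (fun k : ℕ => (exp ((2 ^ k : ℝ)⁻¹ • X) * exp ((2 ^ k : ℝ)⁻¹ • Y)) ^ (2 ^ k)) atTop
      (𝓝 (exp (X + Y))) := by
  have : Nonempty (Fin n) := ⟨⟨0, hn⟩⟩
  have : NormOneClass (Mat n) := Matrix.linfty_opNormOneClass
  exact trotter X Y
end GT

section GT
open Filter Topology NormedSpace

lemma golden_thompson (X Y : Mat n) (hX : X.IsHermitian) (hY : Y.IsHermitian) :
    ‖(exp (X + Y)).trace‖ ≤ ‖(exp X * exp Y).trace‖ := by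
  rcases Nat.eq_zero_or_pos n with rfl | hn
  · simp [Matrix.trace]
  have hlim2 := matrix_trotter hn X Y
  have hpow : ∀ (Z : Mat n) (k : ℕ), exp (((2 ^ k : ℝ)⁻¹) • Z) ^ (2 ^ k) = exp Z := by
    intro Z k
    rw [← Matrix.exp_nsmul]
    congr 1
    rw [← Nat.cast_smul_eq_nsmul ℝ, smul_smul]
    simp
  have hc : Continuous fun Z : Mat n => ‖Z.trace‖ :=
    (Continuous.matrix_trace continuous_id).norm
  have hlim3 := (hc.tendsto _).comp hlim2
  refine le_of_tendsto hlim3 (Eventually.of_forall fun k => ?_)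
  have hh : ∀ Z : Mat n, Z.IsHermitian → (exp (((2 ^ k : ℝ)⁻¹) • Z)).IsHermitian := by
    intro Z hZ
    apply Matrix.IsHermitian.exp
    unfold Matrix.IsHermitian
    rw [conjTranspose_smul, hZ.eq, star_trivial]
  have := gt_dyadic k _ _ (hh X hX) (hh Y hY)
  rw [hpow, hpow] at this
  exact this
end GT


section Spectral

/-- Conjugated real diagonal matrix. -/
noncomputable def cd (U : Mat n) (f : Fin n → ℝ) : Mat n :=
  U * diagonal (fun k => (f k : ℂ)) * Uᴴ

lemma cd_trace (U : Mat n) (hU : Uᴴ * U = 1) (f : Fin n → ℝ) :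
    (cd U f).trace = ((∑ k, f k : ℝ) : ℂ) := by
  rw [cd, Matrix.trace_mul_comm, ← mul_assoc, hU, one_mul, Matrix.trace_diagonal]
  push_cast; rfl

lemma cd_one (U : Mat n) (hU : U * Uᴴ = 1) : cd U (fun _ => 1) = 1 := by
  simp [cd, hU]

lemma cd_mul (U : Mat n) (hU : Uᴴ * U = 1) (f h : Fin n → ℝ) :
    cd U f * cd U h = cd U (fun k => f k * h k) := by
  have : cd U f * cd U h = U * diagonal (fun k => (f k : ℂ)) * (Uᴴ * U) *
      diagonal (fun k => (h k : ℂ)) * Uᴴ := by simp only [cd, mul_assoc]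
  rw [this, hU, mul_one, mul_assoc U, diagonal_mul_diagonal]
  simp [cd]

lemma cd_herm (U : Mat n) (f : Fin n → ℝ) : (cd U f).IsHermitian := by
  unfold Matrix.IsHermitian cd
  rw [conjTranspose_mul, conjTranspose_mul, conjTranspose_conjTranspose, diagonal_conjTranspose,
    mul_assoc]
  congr 3
  ext k
  simp

lemma cd_smul (U : Mat n) (t : ℝ) (f : Fin n → ℝ) : (t : ℂ) • cd U f = cd U (fun k => t * f k) := by
  unfold cd
  rw [← Matrix.smul_mul, ← Matrix.mul_smul, ← diagonal_smul]
  congr 3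
  ext k
  simp

lemma cd_exp (U : Mat n) (hU : Uᴴ * U = 1) (f : Fin n → ℝ) :
    NormedSpace.exp (cd U f) = cd U (fun k => Real.exp (f k)) := by
  have hU' : U * Uᴴ = 1 := mul_eq_one_comm.1 hU
  have hi : U⁻¹ = Uᴴ := Matrix.inv_eq_left_inv hU
  have hu : IsUnit U := ⟨⟨U, Uᴴ, hU', hU⟩, rfl⟩
  unfold cd
  rw [← hi, Matrix.exp_conj U _ hu, Matrix.exp_diagonal]
  congr 3
  ext k
  rw [Pi.coe_exp, ← Complex.exp_eq_exp_ℂ, Complex.ofReal_exp]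

lemma cd_trace_mul (U V : Mat n) (f h : Fin n → ℝ) :
    (cd U f * cd V h).trace = ((∑ k, ∑ l, f k * h l * ‖(Uᴴ * V) k l‖ ^ 2 : ℝ) : ℂ) := by
  have e : cd U f * cd V h = U * (diagonal (fun k => (f k : ℂ)) * (Uᴴ * V) *
      diagonal (fun k => (h k : ℂ)) * Vᴴ) := by simp only [cd, mul_assoc]
  have e2 : diagonal (fun k => (f k : ℂ)) * (Uᴴ * V) * diagonal (fun k => (h k : ℂ)) * Vᴴ * U =
    diagonal (fun k => (f k : ℂ)) * (Uᴴ * V) * diagonal (fun k => (h k : ℂ)) * (Uᴴ * V)ᴴ := by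
    rw [conjTranspose_mul, conjTranspose_conjTranspose, mul_assoc _ Vᴴ]
  rw [e, Matrix.trace_mul_comm, e2]
  generalize Uᴴ * V = Z
  simp only [Matrix.trace, Matrix.diag, Matrix.mul_apply (N := Zᴴ), Matrix.mul_diagonal,
    Matrix.diagonal_mul, conjTranspose_apply]
  push_cast
  refine Finset.sum_congr rfl fun k _ => Finset.sum_congr rfl fun l _ => ?_
  have : Z k l * star (Z k l) = ((‖Z k l‖ ^ 2 : ℝ) : ℂ) := by
    rw [← Complex.normSq_eq_norm_sq, RCLike.star_def, Complex.mul_conj]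
  push_cast at this
  rw [← this]; ring

lemma core (U V W : Mat n) (hU : Uᴴ * U = 1) (hV : Vᴴ * V = 1) (hW : Wᴴ * W = 1)
    (a b c : Fin n → ℝ) (ha : ∀ k, 0 ≤ a k) (hb : ∀ k, 0 ≤ b k)
    (h : cd U a + cd V b = cd W c) (t : ℝ) (ht : 0 < t) :
    ∑ k, ∑ l, (((1 - (2 * Real.sqrt (a k * b l)) * t + (2 * Real.sqrt (a k * b l)) ^ 2 * t ^ 2 / 2)
          - Real.exp (-((2 * Real.sqrt (a k * b l)) * t))) -
        2 * ((1 - Real.sqrt (a k * b l) * t + Real.sqrt (a k * b l) ^ 2 * t ^ 2 / 2)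
          - Real.exp (-(Real.sqrt (a k * b l) * t)))) * ‖(Uᴴ * V) k l‖ ^ 2 ≤
      ∑ k, ((1 - c k * t + c k ^ 2 * t ^ 2 / 2) - Real.exp (-(c k * t))) -
      ∑ k, ((1 - a k * t + a k ^ 2 * t ^ 2 / 2) - Real.exp (-(a k * t))) -
      ∑ k, ((1 - b k * t + b k ^ 2 * t ^ 2 / 2) - Real.exp (-(b k * t))) := by
  have hU' : U * Uᴴ = 1 := mul_eq_one_comm.1 hU
  have hV' : V * Vᴴ = 1 := mul_eq_one_comm.1 hV
  have S0 : ∀ f : Fin n → ℝ, ∑ k, ∑ l, f k * ‖(Uᴴ * V) k l‖ ^ 2 = ∑ k, f k := by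
    intro f
    have := cd_trace_mul U V f (fun _ => 1)
    rw [cd_one V hV', mul_one, cd_trace U hU] at this
    simpa using (Complex.ofReal_injective this).symm
  have S0' : ∀ f : Fin n → ℝ, ∑ k, ∑ l, f l * ‖(Uᴴ * V) k l‖ ^ 2 = ∑ k, f k := by
    intro f
    have := cd_trace_mul U V (fun _ => 1) f
    rw [cd_one U hU', one_mul, cd_trace V hV] at this
    simpa using (Complex.ofReal_injective this).symm
  have S1 : ∑ k, c k = ∑ k, a k + ∑ k, b k := by
    have := congrArg Matrix.trace h
    rw [Matrix.trace_add, cd_trace U hU, cd_trace V hV, cd_trace W hW] at this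
    exact_mod_cast this.symm
  have S2 : ∑ k, c k ^ 2 = ∑ k, a k ^ 2 + ∑ k, b k ^ 2 +
      2 * ∑ k, ∑ l, a k * b l * ‖(Uᴴ * V) k l‖ ^ 2 := by
    have := congrArg (fun Z => (Z * Z).trace) h
    simp only [add_mul, mul_add, Matrix.trace_add, Matrix.trace_mul_comm (cd V b) (cd U a)] at this
    rw [cd_mul U hU, cd_mul V hV, cd_mul W hW, cd_trace U hU, cd_trace V hV, cd_trace W hW,
      cd_trace_mul] at this
    simp only [← pow_two] at this
    have h3 : (∑ k, a k ^ 2) + (∑ k, ∑ l, a k * b l * ‖(Uᴴ * V) k l‖ ^ 2) +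
      ((∑ k, ∑ l, a k * b l * ‖(Uᴴ * V) k l‖ ^ 2) + ∑ k, b k ^ 2) = ∑ k, c k ^ 2 := by
      exact_mod_cast this
    linarith
  have S3 : ∑ k, Real.exp (-(c k * t)) ≤
      ∑ k, ∑ l, Real.exp (-(a k * t)) * Real.exp (-(b l * t)) * ‖(Uᴴ * V) k l‖ ^ 2 := by
    have hsum := congrArg (fun Z => ((-t : ℝ) : ℂ) • Z) h
    simp only [smul_add, cd_smul] at hsum
    have := golden_thompson _ _ (cd_herm U (fun k => -t * a k)) (cd_herm V (fun k => -t * b k))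
    rw [hsum, cd_exp U hU, cd_exp V hV, cd_exp W hW, cd_trace W hW, cd_trace_mul,
      Complex.norm_real, Complex.norm_real, Real.norm_of_nonneg (by positivity),
      Real.norm_of_nonneg (by positivity)] at this
    convert this using 5
    all_goals ring_nf
  have hpt : ∑ k, ∑ l, (((1 - (2 * Real.sqrt (a k * b l)) * t + (2 * Real.sqrt (a k * b l)) ^ 2 * t ^ 2 / 2)
          - Real.exp (-((2 * Real.sqrt (a k * b l)) * t))) -
        2 * ((1 - Real.sqrt (a k * b l) * t + Real.sqrt (a k * b l) ^ 2 * t ^ 2 / 2)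
          - Real.exp (-(Real.sqrt (a k * b l) * t)))) * ‖(Uᴴ * V) k l‖ ^ 2 ≤
      ∑ k, ∑ l, (-(1 * ‖(Uᴴ * V) k l‖ ^ 2) + t ^ 2 * (a k * b l * ‖(Uᴴ * V) k l‖ ^ 2)
        + Real.exp (-(a k * t)) * ‖(Uᴴ * V) k l‖ ^ 2 + Real.exp (-(b l * t)) * ‖(Uᴴ * V) k l‖ ^ 2
        - Real.exp (-(a k * t)) * Real.exp (-(b l * t)) * ‖(Uᴴ * V) k l‖ ^ 2) := by
    refine Finset.sum_le_sum fun k _ => Finset.sum_le_sum fun l _ => ?_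
    have hs := scalar_ineq (mul_nonneg (ha k) ht.le) (mul_nonneg (hb l) ht.le)
    have e : Real.sqrt (a k * t * (b l * t)) = Real.sqrt (a k * b l) * t := by
      rw [show a k * t * (b l * t) = a k * b l * t ^ 2 by ring,
        Real.sqrt_mul (mul_nonneg (ha k) (hb l)), Real.sqrt_sq ht.le]
    rw [e, ← mul_assoc 2] at hs
    have e2 : Real.sqrt (a k * b l) ^ 2 = a k * b l := Real.sq_sqrt (mul_nonneg (ha k) (hb l))
    have hp : 0 ≤ ‖(Uᴴ * V) k l‖ ^ 2 := by positivity
    have := mul_le_mul_of_nonneg_right hs hp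
    rw [mul_pow 2, e2]
    nlinarith
  refine hpt.trans ?_
  have SA := S0 (fun k => Real.exp (-(a k * t)))
  have SB := S0' (fun k => Real.exp (-(b k * t)))
  have S1' := S0 (fun _ => 1)
  simp only [Finset.sum_sub_distrib, Finset.sum_add_distrib, Finset.sum_neg_distrib,
    ← Finset.mul_sum, ← Finset.sum_mul, ← Finset.sum_div] at *
  rw [SA, SB, S1', S1, S2]
  linarith

end Spectral

/-! ### Eigenvalues and functional calculus -/

lemma trace_cfc_eigen (A : Mat n) (hA : A.IsHermitian) (g : ℝ → ℝ) :
    (cfc g A).trace = ((∑ k, g (hA.eigenvalues k) : ℝ) : ℂ) := by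
  rw [hA.cfc_eq, Matrix.IsHermitian.cfc, Unitary.conjStarAlgAut_apply, Matrix.trace_mul_comm,
    ← mul_assoc, Unitary.coe_star_mul_self, one_mul, Matrix.trace_diagonal]
  push_cast; rfl

lemma trace_cfc_cd (U : Mat n) (hU : Uᴴ * U = 1) (a : Fin n → ℝ) (g : ℝ → ℝ) :
    (cfc g (cd U a)).trace = ((∑ k, g (a k) : ℝ) : ℂ) := by
  have hA := cd_herm U a
  rw [trace_cfc_eigen _ hA]
  have h1 : (cd U a).charpoly = (diagonal (fun k => (a k : ℂ))).charpoly := by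
    rw [cd, Matrix.charpoly_mul_comm, ← mul_assoc, hU, one_mul]
  have h2 := hA.roots_charpoly_eq_eigenvalues
  have h4 : (diagonal (fun k => (a k : ℂ))).charpoly.roots =
      Multiset.map (fun k => (a k : ℂ)) Finset.univ.val := by
    rw [Matrix.charpoly_diagonal, Polynomial.roots_prod]
    · simp
    · simp [Finset.prod_ne_zero_iff, Polynomial.X_sub_C_ne_zero]
  rw [h1, h4] at h2
  have h3 := congrArg (fun m => (m.map (fun z : ℂ => g z.re)).sum) h2
  simp only [Multiset.map_map] at h3
  congr 1
  exact h3.symm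

/-- Spectral theorem in `cd` form. -/
lemma exists_cd (A : Mat n) (hA : A.IsHermitian) :
    ∃ W : Mat n, Wᴴ * W = 1 ∧ A = cd W hA.eigenvalues := by
  refine ⟨hA.eigenvectorUnitary, ?_, ?_⟩
  · exact Unitary.coe_star_mul_self hA.eigenvectorUnitary
  · conv_lhs => rw [hA.spectral_theorem, Unitary.conjStarAlgAut_apply]
    rfl

lemma cd_of_vec (a : Fin n → ℝ) (u : Fin n → (Fin n → ℂ)) :
    ∑ k, (a k : ℂ) • Matrix.vecMulVec (u k) (star (u k)) = cd (Matrix.of u)ᵀ a := by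
  ext i j
  rw [Matrix.sum_apply]
  simp only [cd, Matrix.mul_apply (N := ((Matrix.of u)ᵀ)ᴴ), Matrix.mul_diagonal, Matrix.smul_apply,
    vecMulVec_apply, conjTranspose_apply, transpose_apply, of_apply, smul_eq_mul, Pi.star_apply]
  refine Finset.sum_congr rfl fun k _ => ?_
  ring

lemma of_mul (u v : Fin n → (Fin n → ℂ)) (k l : Fin n) :
    (((Matrix.of u)ᵀ)ᴴ * (Matrix.of v)ᵀ) k l = star (u k) ⬝ᵥ v l := by
  simp [Matrix.mul_apply, dotProduct]

end BF2Aux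

open BF2Aux in
/-- The main trace inequality (Theorem 3.8) for functions in the class `BF2`.
Let `A = Σ_k a_k·u_k u_kᴴ` and `B = Σ_l b_l·v_l v_lᴴ` be spectral decompositions of
positive semidefinite matrices `A` and `B`, and let
`g x = ∫_(0,∞) ((1 - x·t + x²·t²/2) - exp(-x·t))·(1/t²) dμ(t)` for a positive measure `μ`
on `(0,∞)` (the integral being finite for every `x ≥ 0`).  Then
`Tr(g(A+B)) - Tr(g(A)) - Tr(g(B))
  ≥ Σ_{k,l} (g(2√(a_k·b_l)) - 2·g(√(a_k·b_l)))·|⟨u_k, v_l⟩|²`,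
where `g` is applied to matrices via the continuous functional calculus. -/
theorem trace_inequality_bf2 {n : ℕ}
    (A B : Matrix (Fin n) (Fin n) ℂ) (hA : A.PosSemidef) (hB : B.PosSemidef)
    (a b : Fin n → ℝ) (ha : ∀ k, 0 ≤ a k) (hb : ∀ l, 0 ≤ b l)
    (u v : Fin n → (Fin n → ℂ))
    (hu : ∀ k l, star (u k) ⬝ᵥ u l = if k = l then 1 else 0)
    (hv : ∀ k l, star (v k) ⬝ᵥ v l = if k = l then 1 else 0)
    (hAdec : A = ∑ k, (a k : ℂ) • Matrix.vecMulVec (u k) (star (u k)))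
    (hBdec : B = ∑ l, (b l : ℂ) • Matrix.vecMulVec (v l) (star (v l)))
    (μ : Measure ℝ) (g : ℝ → ℝ)
    (hint : ∀ x ≥ 0,
      IntegrableOn
        (fun t => ((1 - x * t + x ^ 2 * t ^ 2 / 2) - Real.exp (-(x * t))) * (1 / t ^ 2))
        (Set.Ioi 0) μ)
    (hg : ∀ x ≥ 0, g x = ∫ t in Set.Ioi (0 : ℝ),
      ((1 - x * t + x ^ 2 * t ^ 2 / 2) - Real.exp (-(x * t))) * (1 / t ^ 2) ∂μ) :
    (cfc g (A + B)).trace - (cfc g A).trace - (cfc g B).trace ≥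
      ((∑ k, ∑ l,
        (g (2 * Real.sqrt (a k * b l)) - 2 * g (Real.sqrt (a k * b l))) *
          ‖star (u k) ⬝ᵥ v l‖ ^ 2 : ℝ) : ℂ) := by
  have hU : ((Matrix.of u)ᵀ)ᴴ * (Matrix.of u)ᵀ = 1 := by
    ext k l; rw [of_mul, hu, Matrix.one_apply]
  have hV : ((Matrix.of v)ᵀ)ᴴ * (Matrix.of v)ᵀ = 1 := by
    ext k l; rw [of_mul, hv, Matrix.one_apply]
  have hC : (A + B).PosSemidef := hA.add hB
  obtain ⟨W, hW, hCW⟩ := exists_cd (A + B) hC.1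
  have hc := hC.eigenvalues_nonneg
  rw [trace_cfc_eigen _ hC.1]
  generalize hC.1.eigenvalues = c at *
  rw [cd_of_vec] at hAdec hBdec
  rw [hAdec, hBdec] at hCW
  rw [hAdec, hBdec, trace_cfc_cd _ hU, trace_cfc_cd _ hV, ← Complex.ofReal_sub,
    ← Complex.ofReal_sub, ge_iff_le, Complex.real_le_real]
  set F : ℝ → ℝ → ℝ := fun x t =>
    ((1 - x * t + x ^ 2 * t ^ 2 / 2) - Real.exp (-(x * t))) * (1 / t ^ 2) with hF
  have hI : ∀ x, 0 ≤ x → Integrable (F x) (μ.restrict (Set.Ioi 0)) := fun x hx => hint x hx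
  have hG : ∀ x, 0 ≤ x → g x = ∫ t, F x t ∂(μ.restrict (Set.Ioi 0)) := fun x hx => hg x hx
  have hsum : ∀ d : Fin n → ℝ, (∀ k, 0 ≤ d k) →
      ∑ k, g (d k) = ∫ t, ∑ k, F (d k) t ∂(μ.restrict (Set.Ioi 0)) := by
    intro d hd
    rw [integral_finsetSum _ (fun k _ => hI _ (hd k))]
    exact Finset.sum_congr rfl fun k _ => hG _ (hd k)
  have hsumI : ∀ d : Fin n → ℝ, (∀ k, 0 ≤ d k) →
      Integrable (fun t => ∑ k, F (d k) t) (μ.restrict (Set.Ioi 0)) :=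
    fun d hd => integrable_finsetSum _ (fun k _ => hI _ (hd k))
  have hs : ∀ k l, 0 ≤ Real.sqrt (a k * b l) := fun k l => Real.sqrt_nonneg _
  have hs2 : ∀ k l, 0 ≤ 2 * Real.sqrt (a k * b l) := fun k l => by positivity
  have hRI : ∀ k l, Integrable (fun t => (F (2 * Real.sqrt (a k * b l)) t -
      2 * F (Real.sqrt (a k * b l)) t) * ‖star (u k) ⬝ᵥ v l‖ ^ 2) (μ.restrict (Set.Ioi 0)) :=
    fun k l => ((hI _ (hs2 k l)).sub ((hI _ (hs k l)).const_mul 2)).mul_const _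
  have hR : ∑ k, ∑ l, (g (2 * Real.sqrt (a k * b l)) - 2 * g (Real.sqrt (a k * b l))) *
          ‖star (u k) ⬝ᵥ v l‖ ^ 2 = ∫ t, ∑ k, ∑ l, (F (2 * Real.sqrt (a k * b l)) t -
      2 * F (Real.sqrt (a k * b l)) t) * ‖star (u k) ⬝ᵥ v l‖ ^ 2 ∂(μ.restrict (Set.Ioi 0)) := by
    rw [integral_finsetSum _ (fun k _ => integrable_finsetSum _ fun l _ => hRI k l)]
    refine Finset.sum_congr rfl fun k _ => ?_
    rw [integral_finsetSum _ (fun l _ => hRI k l)]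
    refine Finset.sum_congr rfl fun l _ => ?_
    rw [integral_mul_const, integral_sub (hI _ (hs2 k l)) ((hI _ (hs k l)).const_mul 2),
      integral_const_mul, hG _ (hs2 k l), hG _ (hs k l)]
  rw [hR, hsum c hc, hsum a ha, hsum b hb, ← integral_sub (hsumI c hc) (hsumI a ha)]
  have hsub := integral_sub ((hsumI c hc).sub (hsumI a ha)) (hsumI b hb)
  simp only [Pi.sub_apply] at hsub
  rw [← hsub]
  refine integral_mono_ae
    (integrable_finsetSum _ fun k _ => integrable_finsetSum _ fun l _ => hRI k l)
    (((hsumI c hc).sub (hsumI a ha)).sub (hsumI b hb)) ?_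
  filter_upwards [ae_restrict_mem measurableSet_Ioi] with t ht
  have hcore := core _ _ W hU hV hW a b c ha hb hCW t ht
  have hm := mul_le_mul_of_nonneg_right hcore (by positivity : 0 ≤ 1 / t ^ 2)
  simp only [of_mul] at hm
  refine le_trans (le_of_eq ?_) (hm.trans (le_of_eq ?_))
  · simp only [Finset.sum_mul, hF]
    refine Finset.sum_congr rfl fun k _ => Finset.sum_congr rfl fun l _ => ?_
    ring
  · simp only [sub_mul _ _ (1 / t ^ 2), Finset.sum_mul, hF]
end

section
/- Let A and B be positive definite n×n complex matrices, let μ be a (positive) measure on (0,∞), and let f : (0,∞) → ℝ be given by f(x) = ∫_(0,∞) exp(-x·t) dμ(t), where this integral is finite for every x > 0. Then Tr(f(A+B)) ≤ Tr(f(A)) + Tr(f(B)), where f is applied to a positive definite matrix via the continuous functional calculus (i.e., by applying f to the eigenvalues in a spectral decomposition). -/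
open MeasureTheory ComplexOrder

lemma cm0_trace_cfc {n : ℕ} {A : Matrix (Fin n) (Fin n) ℂ} (hA : A.IsHermitian) (f : ℝ → ℝ) :
    (cfc f A).trace = ((∑ i, f (hA.eigenvalues i) : ℝ) : ℂ) := by
  rw [hA.cfc_eq f, Matrix.IsHermitian.cfc, Unitary.conjStarAlgAut_apply, Matrix.trace_mul_comm,
    ← mul_assoc, Unitary.coe_star_mul_self, one_mul, Matrix.trace_diagonal]
  simp

/-- A doubly stochastic comparison between the spectra of `A` and `A + B`. -/
lemma cm0_eigenvalues {n : ℕ} {A B : Matrix (Fin n) (Fin n) ℂ} (hA : A.IsHermitian)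
    (hB : B.PosSemidef) (hM : (A + B).IsHermitian) :
    ∃ P : Fin n → Fin n → ℝ, (∀ i j, 0 ≤ P i j) ∧ (∀ i, ∑ j, P i j = 1) ∧ (∀ j, ∑ i, P i j = 1) ∧
      ∀ j, ∑ i, P i j * hA.eigenvalues i ≤ hM.eigenvalues j := by
  set W : Matrix.unitaryGroup (Fin n) ℂ := star hA.eigenvectorUnitary * hM.eigenvectorUnitary
    with hW
  have key : ∀ j, (∑ i, Complex.normSq ((W : Matrix (Fin n) (Fin n) ℂ) i j) * hA.eigenvalues i)
      ≤ hM.eigenvalues j := by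
    intro j
    have h1 := hM.conjStarAlgAut_star_eigenvectorUnitary
    have h2 := hA.spectral_theorem
    rw [map_add, Unitary.conjStarAlgAut_star_apply, Unitary.conjStarAlgAut_star_apply] at h1
    have h3 := (hB.conjTranspose_mul_mul_same
      (hM.eigenvectorUnitary : Matrix (Fin n) (Fin n) ℂ)).diag_nonneg (i := j)
    rw [Unitary.conjStarAlgAut_apply] at h2
    have h4 : star (hM.eigenvectorUnitary : Matrix (Fin n) (Fin n) ℂ) * A
        * (hM.eigenvectorUnitary : Matrix (Fin n) (Fin n) ℂ) =
        star (W : Matrix (Fin n) (Fin n) ℂ) * Matrix.diagonal (RCLike.ofReal ∘ hA.eigenvalues)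
          * (W : Matrix (Fin n) (Fin n) ℂ) := by
      refine (congrArg (fun X => star (hM.eigenvectorUnitary : Matrix (Fin n) (Fin n) ℂ) * X
        * (hM.eigenvectorUnitary : Matrix (Fin n) (Fin n) ℂ)) h2).trans ?_
      simp only [hW, Submonoid.coe_mul, Unitary.coe_star, star_mul, star_star, mul_assoc]
    have h5 := congrFun (congrFun h1 j) j
    rw [h4, Matrix.add_apply, Matrix.diagonal_apply_eq] at h5
    have h6 := congrArg Complex.re h5
    have h7 := (Complex.le_def.1 h3).1
    rw [← Matrix.star_eq_conjTranspose] at h7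
    rw [Complex.add_re] at h6
    simp only [Function.comp_apply, Complex.coe_algebraMap,
      Complex.ofReal_re, Complex.zero_re] at h6 h7
    rw [← h6]
    refine le_trans (le_of_eq ?_) (le_add_of_nonneg_right h7)
    rw [Matrix.mul_apply, Complex.re_sum]
    refine Finset.sum_congr rfl fun i _ => ?_
    rw [Matrix.mul_diagonal]
    simp [Matrix.star_apply, Complex.normSq_apply]
    ring
  refine ⟨fun i j => Complex.normSq ((W : Matrix (Fin n) (Fin n) ℂ) i j),
    fun i j => Complex.normSq_nonneg _, fun i => ?_, fun j => ?_, key⟩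
  · have h := congrFun (congrFun (Unitary.coe_mul_star_self W) i) i
    rw [Matrix.mul_apply, Matrix.one_apply_eq] at h
    have h := congrArg Complex.re h
    rw [Complex.re_sum, Complex.one_re] at h
    rw [← h]
    exact Finset.sum_congr rfl fun k _ => by simp [Matrix.star_apply, Complex.normSq_apply]
  · have h := congrFun (congrFun (Unitary.coe_star_mul_self W) j) j
    rw [Matrix.mul_apply, Matrix.one_apply_eq] at h
    have h := congrArg Complex.re h
    rw [Complex.re_sum, Complex.one_re] at h
    rw [← h]
    exact Finset.sum_congr rfl fun k _ => by simp [Matrix.star_apply, Complex.normSq_apply]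

/-- Trace subadditivity for bare completely monotone functions (Lemma 3.9, case `CM0`):
if `A` and `B` are positive definite matrices and
`f x = ∫_(0,∞) exp(-x·t) dμ(t)` for a positive measure `μ` on `(0,∞)`
(the integral being finite for every `x > 0`), then
`Tr(f(A+B)) ≤ Tr(f(A)) + Tr(f(B))`, where `f` is applied to matrices via the
continuous functional calculus. -/
theorem trace_subadditive_cm0 {n : ℕ}
    (A B : Matrix (Fin n) (Fin n) ℂ) (hA : A.PosDef) (hB : B.PosDef)
    (μ : Measure ℝ) (f : ℝ → ℝ)
    (hint : ∀ x > 0, IntegrableOn (fun t => Real.exp (-(x * t))) (Set.Ioi 0) μ)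
    (hf : ∀ x > 0, f x = ∫ t in Set.Ioi (0 : ℝ), Real.exp (-(x * t)) ∂μ) :
    (cfc f (A + B)).trace ≤ (cfc f A).trace + (cfc f B).trace := by
  have hanti : ∀ x y, 0 < x → x ≤ y → f y ≤ f x := by
    intro x y hx hxy
    rw [hf x hx, hf y (hx.trans_le hxy)]
    refine setIntegral_mono_on (hint y (hx.trans_le hxy)) (hint x hx) measurableSet_Ioi ?_
    intro t ht
    have ht : 0 < t := ht
    gcongr
  have hnn : ∀ x, 0 < x → 0 ≤ f x := by
    intro x hx
    rw [hf x hx]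
    exact integral_nonneg fun t => (Real.exp_pos _).le
  have hconv : ConvexOn ℝ (Set.Ioi 0) f := by
    refine ⟨convex_Ioi 0, ?_⟩
    intro x hx y hy a b ha hb hab
    have hz : a • x + b • y ∈ Set.Ioi (0 : ℝ) := convex_Ioi 0 hx hy ha hb hab
    simp only [smul_eq_mul] at hz ⊢
    rw [hf x hx, hf y hy, hf _ hz, ← integral_const_mul,
      ← integral_const_mul, ← integral_add ((hint x hx).const_mul a) ((hint y hy).const_mul b)]
    refine integral_mono (hint _ hz)
      (((hint x hx).const_mul a).add ((hint y hy).const_mul b)) fun t => ?_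
    have h := convexOn_exp.2 (Set.mem_univ (-(x * t))) (Set.mem_univ (-(y * t))) ha hb hab
    simp only [smul_eq_mul] at h ⊢
    convert h using 2
    ring
  have hM : (A + B).PosDef := hA.add hB
  rw [cm0_trace_cfc hM.1, cm0_trace_cfc hA.1, cm0_trace_cfc hB.1, ← Complex.ofReal_add,
    Complex.real_le_real]
  have hB0 : 0 ≤ ∑ i, f (hB.1.eigenvalues i) :=
    Finset.sum_nonneg fun i _ => hnn _ (hB.eigenvalues_pos i)
  refine le_trans ?_ (le_add_of_nonneg_right hB0)
  obtain ⟨P, hP0, hP1, hP2, hP⟩ := cm0_eigenvalues hA.1 hB.posSemidef hM.1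
  calc ∑ j, f (hM.1.eigenvalues j)
      ≤ ∑ j, ∑ i, P i j * f (hA.1.eigenvalues i) := by
        refine Finset.sum_le_sum fun j _ => ?_
        have hmem : ∀ i ∈ Finset.univ, hA.1.eigenvalues i ∈ Set.Ioi (0 : ℝ) :=
          fun i _ => hA.eigenvalues_pos i
        have hpos := (convex_Ioi (0 : ℝ)).sum_mem (fun i _ => hP0 i j) (hP2 j) hmem
        have hJ := hconv.map_sum_le (fun i _ => hP0 i j) (hP2 j) hmem
        simp only [smul_eq_mul] at hpos hJ
        exact (hanti _ _ hpos (hP j)).trans hJ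
    _ = ∑ i, f (hA.1.eigenvalues i) := by
        rw [Finset.sum_comm]
        refine Finset.sum_congr rfl fun i _ => ?_
        rw [← Finset.sum_mul, hP1 i, one_mul]
end
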